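/- arXiv:1905.01396 — 13 statements merged into one kernel-verified Lean document; each statement's English description precedes it below -/
import Mathlib

section
/- Let λ be a nonzero real number and let (u₁,u₂) and (u₁′,u₂′) be points of ℝ² \ {(0,0)}. Then there exists t ∈ ℝ such that u₁′ = e^{λt}·u₁ and u₂′ = e^{t}·u₂ if and only if one of the following holds: (a) u₁·u₁′ > 0 and u₂ = u₂′ = 0; or (b) u₂·u₂′ > 0 and u₁·|u₂′|^λ = u₁′·|u₂|^λ. -/
theorem exists_eq_exp_mul_of_mul_pos {a b : ℝ} (hab : 0 < a * b) :
    ∃ t : ℝ, b = Real.exp t * a := by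
  have ha : a ≠ 0 := left_ne_zero_of_mul hab.ne'
  have hdiv : 0 < b / a := by
    rw [show b / a = a * b / a ^ 2 by field_simp]
    positivity
  exact ⟨Real.log (b / a), by rw [Real.exp_log hdiv, div_mul_cancel₀ b ha]⟩

theorem abs_exp_mul_rpow (lam t u : ℝ) :
    |Real.exp t * u| ^ lam = Real.exp (lam * t) * |u| ^ lam := by
  rw [abs_mul, Real.abs_exp, Real.mul_rpow (Real.exp_pos t).le (abs_nonneg u),
    ← Real.exp_mul, mul_comm t lam]

/-- Orbit characterization for the diagonal case (I) of the Lie-derivative action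
`diag(λ, 1)` on the Liouville metrization space: two nonzero points of ℝ² are related
by the flow `(u₁,u₂) ↦ (e^{λt}u₁, e^t u₂)` iff they satisfy (a) or (b). -/
theorem stmt_0 (lam : ℝ) (hlam : lam ≠ 0)
    (u₁ u₂ u₁' u₂' : ℝ)
    (h : (u₁, u₂) ≠ (0, 0)) (h' : (u₁', u₂') ≠ (0, 0)) :
    (∃ t : ℝ, u₁' = Real.exp (lam * t) * u₁ ∧ u₂' = Real.exp t * u₂) ↔
      ((u₁ * u₁' > 0 ∧ u₂ = 0 ∧ u₂' = 0) ∨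
       (u₂ * u₂' > 0 ∧ u₁ * |u₂'| ^ lam = u₁' * |u₂| ^ lam)) := by
  constructor
  · rintro ⟨t, rfl, rfl⟩
    by_cases hu₂ : u₂ = 0
    · subst hu₂
      have hu₁ : u₁ ≠ 0 := by
        rintro rfl
        exact h rfl
      refine Or.inl ⟨?_, rfl, mul_zero _⟩
      rw [mul_left_comm]
      exact mul_pos (Real.exp_pos _) (mul_self_pos.mpr hu₁)
    · refine Or.inr ⟨?_, ?_⟩
      · rw [mul_left_comm]
        exact mul_pos (Real.exp_pos _) (mul_self_pos.mpr hu₂)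
      · rw [abs_exp_mul_rpow]
        ring
  · rintro (⟨hpos, rfl, rfl⟩ | ⟨hpos, heq⟩)
    · obtain ⟨s, hs⟩ := exists_eq_exp_mul_of_mul_pos hpos
      exact ⟨s / lam, by rwa [mul_div_cancel₀ s hlam], (mul_zero _).symm⟩
    · obtain ⟨t, rfl⟩ := exists_eq_exp_mul_of_mul_pos hpos
      refine ⟨t, ?_, rfl⟩
      have hu₂ : |u₂| ^ lam ≠ 0 :=
        (Real.rpow_pos_of_pos (abs_pos.mpr (left_ne_zero_of_mul hpos.ne')) lam).ne'
      rw [abs_exp_mul_rpow] at heq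
      apply mul_right_cancel₀ hu₂
      linear_combination -heq
end

section
/- Let (u₁,u₂) and (u₁′,u₂′) be points of ℝ² \ {(0,0)}. Then there exists t ∈ ℝ such that u₁′ = e^{t}·u₁ and u₂′ = e^{t}·(t·u₁ + u₂) if and only if one of the following holds: (a) u₁ = u₁′ = 0 and u₂·u₂′ > 0; or (b) u₁·u₁′ > 0 and (1/u₁′)·e^{u₂′/u₁′} = (1/u₁)·e^{u₂/u₁}. -/
/-- Orbit characterization for the Jordan-block case (II) of the Lie-derivative action
`[[1,1],[0,1]]` on the Liouville metrization space: two nonzero points of ℝ² are related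
by the flow `(u₁,u₂) ↦ (e^t u₁, e^t (t u₁ + u₂))` iff they satisfy (a) or (b). -/
theorem stmt_1 (u₁ u₂ u₁' u₂' : ℝ)
    (h : (u₁, u₂) ≠ (0, 0)) (h' : (u₁', u₂') ≠ (0, 0)) :
    (∃ t : ℝ, u₁' = Real.exp t * u₁ ∧ u₂' = Real.exp t * (t * u₁ + u₂)) ↔
      ((u₁ = 0 ∧ u₁' = 0 ∧ u₂ * u₂' > 0) ∨
       (u₁ * u₁' > 0 ∧
         (1 / u₁') * Real.exp (u₂' / u₁') = (1 / u₁) * Real.exp (u₂ / u₁))) := by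
  have div_pos_of_mul_pos : ∀ {a b : ℝ}, 0 < a * b → 0 < b / a := by
    intro a b hab
    rcases pos_and_pos_or_neg_and_neg_of_mul_pos hab with ⟨ha, hb⟩ | ⟨ha, hb⟩
    · exact div_pos hb ha
    · exact div_pos_of_neg_of_neg hb ha
  constructor
  · rintro ⟨t, rfl, rfl⟩
    have ht := Real.exp_pos t
    by_cases hu : u₁ = 0
    · subst hu
      have hu₂ : u₂ ≠ 0 := by
        rintro rfl
        exact h rfl
      refine Or.inl ⟨rfl, mul_zero _, ?_⟩
      have : u₂ * (Real.exp t * (t * 0 + u₂)) = Real.exp t * u₂ ^ 2 := by ring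
      rw [this]
      positivity
    · refine Or.inr ⟨?_, ?_⟩
      · have : u₁ * (Real.exp t * u₁) = Real.exp t * u₁ ^ 2 := by ring
        rw [this]
        positivity
      · have : Real.exp t * (t * u₁ + u₂) / (Real.exp t * u₁) = t + u₂ / u₁ := by
          field_simp
        rw [this, Real.exp_add]
        field_simp
  · rintro (⟨rfl, rfl, hpos⟩ | ⟨hpos, heq⟩)
    · have hu₂ : u₂ ≠ 0 := left_ne_zero_of_mul hpos.ne'
      refine ⟨Real.log (u₂' / u₂), by simp, ?_⟩
      rw [Real.exp_log (div_pos_of_mul_pos hpos)]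
      field_simp
      simp
    · have hu : u₁ ≠ 0 := left_ne_zero_of_mul hpos.ne'
      have hu' : u₁' ≠ 0 := right_ne_zero_of_mul hpos.ne'
      have hexp := Real.exp_log (div_pos_of_mul_pos hpos)
      have hratio : u₂' / u₁' = Real.log (u₁' / u₁) + u₂ / u₁ := by
        apply Real.exp_injective
        rw [Real.exp_add, hexp]
        field_simp at heq ⊢
        linarith
      refine ⟨Real.log (u₁' / u₁), ?_, ?_⟩
      · rw [hexp]
        field_simp
      · rw [hexp, (div_eq_iff hu').1 hratio]
        field_simp
end

section
/- Let λ ≥ 0 be real, let u, u′ > 0 and s, s′ ∈ ℝ, and set u₁ = u·e^{λs}·sin(s), u₂ = u·e^{λs}·cos(s), u₁′ = u′·e^{λs′}·sin(s′), u₂′ = u′·e^{λs′}·cos(s′). Assume either λ = 0, or λ > 0 together with 1 ≤ u < e^{2πλ} and 1 ≤ u′ < e^{2πλ}. Then there exists t ∈ ℝ such that u₁′ = e^{λt}·(u₁·cos(t) + u₂·sin(t)) and u₂′ = e^{λt}·(u₂·cos(t) − u₁·sin(t)) if and only if u′ = u. -/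
/-- Polar coordinates with positive radii agree iff the radii agree and the angles agree
modulo `2π`; this is the forward direction. -/
theorem polar_eq_imp {A B a b : ℝ} (hA : 0 < A) (hB : 0 < B)
    (hs : A * Real.sin a = B * Real.sin b) (hc : A * Real.cos a = B * Real.cos b) :
    A = B ∧ ∃ n : ℤ, b = a + n * (2 * Real.pi) := by
  have hAB : A = B := by
    have h : A ^ 2 = B ^ 2 := by
      calc A ^ 2 = (A * Real.sin a) ^ 2 + (A * Real.cos a) ^ 2 := by
            linear_combination -A ^ 2 * Real.sin_sq_add_cos_sq a
        _ = B ^ 2 := by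
            rw [hs, hc]
            linear_combination B ^ 2 * Real.sin_sq_add_cos_sq b
    exact (pow_left_inj₀ hA.le hB.le two_ne_zero).1 h
  subst hAB
  have hs' := mul_left_cancel₀ hA.ne' hs
  have hc' := mul_left_cancel₀ hA.ne' hc
  have h1 : Real.cos (b - a) = 1 := by
    rw [Real.cos_sub, hs', hc']
    linear_combination Real.sin_sq_add_cos_sq b
  obtain ⟨n, hn⟩ := (Real.cos_eq_one_iff _).1 h1
  exact ⟨rfl, n, by linarith⟩

/-- If `v = u * e^{n c}` with `n ≥ 1`, `c ≥ 0` and `u ≥ 1`, then `v ≥ e^c`. -/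
theorem exp_le_of_eq_mul_exp {u v c : ℝ} {n : ℤ} (hc : 0 ≤ c) (hn : 1 ≤ n) (hu : 1 ≤ u)
    (h : v = u * Real.exp (n * c)) : Real.exp c ≤ v := by
  have hn' : (1 : ℝ) ≤ n := by exact_mod_cast hn
  calc Real.exp c ≤ Real.exp (n * c) := Real.exp_le_exp.2 (le_mul_of_one_le_left hc hn')
    _ ≤ u * Real.exp (n * c) := le_mul_of_one_le_left (Real.exp_pos _).le hu
    _ = v := h.symm


/-- Orbit characterization for case (III) of the Lie-derivative action
`[[λ,−1],[1,λ]]`: in spiral coordinates `(s,u) ↦ (u e^{λs} sin s, u e^{λs} cos s)`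
(with `u` normalized to `[1, e^{2πλ})` when `λ > 0`), two points are related by the flow
`(u₁,u₂) ↦ e^{λt}(u₁ cos t + u₂ sin t, u₂ cos t − u₁ sin t)` iff `u′ = u`. -/
theorem stmt_2 (lam : ℝ) (hlam : 0 ≤ lam) (u u' s s' : ℝ) (hu : 0 < u) (hu' : 0 < u')
    (hcase : lam = 0 ∨
      (0 < lam ∧ 1 ≤ u ∧ u < Real.exp (2 * Real.pi * lam) ∧
        1 ≤ u' ∧ u' < Real.exp (2 * Real.pi * lam)))
    (u₁ u₂ u₁' u₂' : ℝ)
    (h1 : u₁ = u * Real.exp (lam * s) * Real.sin s)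
    (h2 : u₂ = u * Real.exp (lam * s) * Real.cos s)
    (h1' : u₁' = u' * Real.exp (lam * s') * Real.sin s')
    (h2' : u₂' = u' * Real.exp (lam * s') * Real.cos s') :
    (∃ t : ℝ,
        u₁' = Real.exp (lam * t) * (u₁ * Real.cos t + u₂ * Real.sin t) ∧
        u₂' = Real.exp (lam * t) * (u₂ * Real.cos t - u₁ * Real.sin t)) ↔ u' = u := by
  subst h1 h2 h1' h2'
  constructor
  · rintro ⟨t, hs, hc⟩
    have he : Real.exp (lam * (s + t)) = Real.exp (lam * s) * Real.exp (lam * t) := by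
      rw [mul_add, Real.exp_add]
    obtain ⟨hr, n, hn⟩ := polar_eq_imp (A := u' * Real.exp (lam * s'))
      (B := u * Real.exp (lam * (s + t))) (a := s') (b := s + t)
      (by positivity) (by positivity)
      (by rw [hs, he, Real.sin_add]; ring) (by rw [hc, he, Real.cos_add]; ring)
    have key : u' = u * Real.exp (n * (2 * Real.pi * lam)) := by
      have h : lam * (s + t) = n * (2 * Real.pi * lam) + lam * s' := by rw [hn]; ring
      rw [h, Real.exp_add, ← mul_assoc] at hr
      exact mul_right_cancel₀ (Real.exp_pos _).ne' hr
    rcases hcase with h0 | ⟨hpos, hu1, hu2, hu1', hu2'⟩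
    · simpa [h0] using key
    · have hc0 : 0 ≤ 2 * Real.pi * lam := by positivity
      have key' : u = u' * Real.exp ((-n : ℤ) * (2 * Real.pi * lam)) := by
        rw [key, mul_assoc, ← Real.exp_add]
        simp
      have hn0 : n = 0 := by
        rcases lt_trichotomy n 0 with h | h | h
        · exact absurd (exp_le_of_eq_mul_exp hc0 (by lia) hu1' key') hu2.not_ge
        · exact h
        · exact absurd (exp_le_of_eq_mul_exp hc0 (by lia) hu1 key) hu2'.not_ge
      simpa [hn0] using key
  · rintro rfl
    have he : Real.exp (lam * s') = Real.exp (lam * (s' - s)) * Real.exp (lam * s) := by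
      rw [← Real.exp_add]; ring_nf
    have hsin := Real.sin_add s (s' - s)
    have hcos := Real.cos_add s (s' - s)
    rw [add_sub_cancel] at hsin hcos
    refine ⟨s' - s, ?_, ?_⟩
    · rw [he, hsin]; ring
    · rw [he, hcos]; ring
end

section
/- Let N ≥ 2, let U ⊆ ℝ^N be open, and let Γ^k_{ij} : U → ℝ (1 ≤ i,j,k ≤ N) be continuous functions with Γ^k_{ij} = Γ^k_{ji}. Let γ = (γ¹,…,γ^N) : I → U be a C² curve on an open interval I satisfying the geodesic equations (γ^k)″(t) + Σ_{i,j=1}^N Γ^k_{ij}(γ(t))·(γ^i)′(t)·(γ^j)′(t) = 0 for all k and all t ∈ I, and assume (γ¹)′(t) > 0 for all t ∈ I. Let s : J → I be the inverse function of γ¹ on J = γ¹(I), and set Y^k := γ^k ∘ s for k = 2,…,N. Then each Y^k is twice differentiable on J and for all x ∈ J: (Y^k)″(x) = −Γ^k_{11} − Σ_{i=2}^N (2Γ^k_{1i} − δ^k_i Γ¹_{11})·(Y^i)′(x) − Σ_{i,j=2}^N (Γ^k_{ij} − 2δ^k_i Γ¹_{1j})·(Y^i)′(x)(Y^j)′(x)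 + Σ_{i,j=2}^N Γ¹_{ij}·(Y^i)′(x)(Y^j)′(x)(Y^k)′(x), where all Christoffel symbols Γ are evaluated at the point (x, Y²(x), …, Y^N(x)) and δ^k_i is the Kronecker delta. -/
/-- The right-hand side of the quotient system (projective connection) associated to
symmetric connection coefficients `Γ` (with `Γ k i j = Γ^k_{ij}`, index `0` playing the
role of the coordinate `x = y¹`), evaluated at the point `p` with slopes `v`. -/
def quotRHS (N : ℕ) [NeZero N] (Γ : Fin N → Fin N → Fin N → (Fin N → ℝ) → ℝ)
    (p v : Fin N → ℝ) (k : Fin N) : ℝ :=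
  - Γ k 0 0 p
  - ∑ i ∈ Finset.univ.erase 0,
      (2 * Γ k 0 i p - (if k = i then (1 : ℝ) else 0) * Γ 0 0 0 p) * v i
  - ∑ i ∈ Finset.univ.erase 0, ∑ j ∈ Finset.univ.erase 0,
      (Γ k i j p - 2 * (if k = i then (1 : ℝ) else 0) * Γ 0 0 j p) * v i * v j
  + ∑ i ∈ Finset.univ.erase 0, ∑ j ∈ Finset.univ.erase 0,
      Γ 0 i j p * v i * v j * v k

/-- A left inverse, on an open set, of a function with continuous nonvanishing derivative is
differentiable, with the reciprocal derivative. -/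
lemma hasDerivAt_leftInverse_of_isOpen {f f' s : ℝ → ℝ} {I : Set ℝ} (hI : IsOpen I)
    (hf : ∀ t ∈ I, HasDerivAt f (f' t) t) {t : ℝ} (ht : t ∈ I) (hc : ContinuousAt f' t)
    (h0 : f' t ≠ 0) (hs : ∀ t ∈ I, s (f t) = t) : HasDerivAt s (f' t)⁻¹ (f t) := by
  have hstrict : HasStrictDerivAt f (f' t) t :=
    hasStrictDerivAt_of_hasDerivAt_of_continuousAt
      ((hI.eventually_mem ht).mono hf) hc
  exact (hstrict.to_local_left_inverse h0 ((hI.eventually_mem ht).mono hs)).hasDerivAt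

/-- The right-hand side of the quotient system in homogeneous form: when the slope vector is
normalized by `v 0 = 1`, it is the difference of two full quadratic forms. -/
lemma quotRHS_eq_of_apply_zero_eq_one {N : ℕ} [NeZero N]
    {Γ : Fin N → Fin N → Fin N → (Fin N → ℝ) → ℝ}
    (hΓsymm : ∀ k i j p, Γ k i j p = Γ k j i p) (p : Fin N → ℝ) {v : Fin N → ℝ}
    (hv : v 0 = 1) {k : Fin N} (hk : k ≠ 0) :
    quotRHS N Γ p v k =
      -∑ i, ∑ j, Γ k i j p * v i * v j + v k * ∑ i, ∑ j, Γ 0 i j p * v i * v j := by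
  have hmem : k ∈ Finset.univ.erase (0 : Fin N) := by simp [hk]
  have split (F : Fin N → ℝ) : ∑ i, F i = F 0 + ∑ i ∈ Finset.univ.erase 0, F i :=
    (Finset.add_sum_erase _ _ (Finset.mem_univ 0)).symm
  have full (l : Fin N) : ∑ i, ∑ j, Γ l i j p * v i * v j =
      Γ l 0 0 p + 2 * ∑ i ∈ Finset.univ.erase 0, Γ l 0 i p * v i +
        ∑ i ∈ Finset.univ.erase 0, ∑ j ∈ Finset.univ.erase 0, Γ l i j p * v i * v j := by
    have inner (i : Fin N) : ∑ j, Γ l i j p * v i * v j =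
        Γ l 0 i p * v i + ∑ j ∈ Finset.univ.erase 0, Γ l i j p * v i * v j := by
      rw [split, hv, mul_one, hΓsymm l i 0]
    simp only [inner, Finset.sum_add_distrib, split (fun i => Γ l 0 i p * v i),
      split (fun i => ∑ j ∈ Finset.univ.erase 0, Γ l i j p * v i * v j), hv, mul_one]
    ring
  have linear : ∑ i ∈ Finset.univ.erase 0,
      (2 * Γ k 0 i p - (if k = i then (1 : ℝ) else 0) * Γ 0 0 0 p) * v i =
      2 * ∑ i ∈ Finset.univ.erase 0, Γ k 0 i p * v i - Γ 0 0 0 p * v k := by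
    simp only [sub_mul, Finset.sum_sub_distrib, Finset.mul_sum, mul_assoc]
    congr 1
    rw [Finset.sum_eq_single_of_mem k hmem (fun i _ hi => by simp [Ne.symm hi]), if_pos rfl,
      one_mul]
  have quadratic : ∑ i ∈ Finset.univ.erase 0, ∑ j ∈ Finset.univ.erase 0,
      (Γ k i j p - 2 * (if k = i then (1 : ℝ) else 0) * Γ 0 0 j p) * v i * v j =
      ∑ i ∈ Finset.univ.erase 0, ∑ j ∈ Finset.univ.erase 0, Γ k i j p * v i * v j -
        2 * v k * ∑ j ∈ Finset.univ.erase 0, Γ 0 0 j p * v j := by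
    simp only [sub_mul, Finset.sum_sub_distrib]
    congr 1
    rw [Finset.sum_eq_single_of_mem k hmem (fun i _ hi => by simp [Ne.symm hi]), Finset.mul_sum]
    exact Finset.sum_congr rfl fun j _ => by rw [if_pos rfl]; ring
  rw [quotRHS, linear, quadratic, full, full]
  simp only [← Finset.sum_mul]
  ring

/-- A geodesic of symmetric continuous connection coefficients `Γ` with increasing first
coordinate, reparametrized by its first coordinate, solves the quotient system
(the projective connection). -/
theorem stmt_6 (N : ℕ) (hN : 2 ≤ N) [NeZero N]
    (U : Set (Fin N → ℝ)) (hU : IsOpen U)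
    (Γ : Fin N → Fin N → Fin N → (Fin N → ℝ) → ℝ)
    (hΓc : ∀ k i j, ContinuousOn (Γ k i j) U)
    (hΓsymm : ∀ k i j p, Γ k i j p = Γ k j i p)
    (I : Set ℝ) (hIopen : IsOpen I) (hIconn : I.OrdConnected)
    (γ γ' γ'' : ℝ → Fin N → ℝ)
    (hmem : ∀ t ∈ I, γ t ∈ U)
    (hd1 : ∀ t ∈ I, ∀ k, HasDerivAt (fun τ => γ τ k) (γ' t k) t)
    (hd2 : ∀ t ∈ I, ∀ k, HasDerivAt (fun τ => γ' τ k) (γ'' t k) t)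
    (hgeo : ∀ t ∈ I, ∀ k, γ'' t k + ∑ i, ∑ j, Γ k i j (γ t) * γ' t i * γ' t j = 0)
    (hpos : ∀ t ∈ I, 0 < γ' t 0)
    (s : ℝ → ℝ) (hs : ∀ t ∈ I, s (γ t 0) = t) :
    ∃ Y' Y'' : ℝ → Fin N → ℝ,
      (∀ x ∈ (fun t => γ t 0) '' I, ∀ k, HasDerivAt (fun z => γ (s z) k) (Y' x k) x) ∧
      (∀ x ∈ (fun t => γ t 0) '' I, ∀ k, HasDerivAt (fun z => Y' z k) (Y'' x k) x) ∧
      (∀ x ∈ (fun t => γ t 0) '' I, ∀ k, k ≠ 0 →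
        Y'' x k = quotRHS N Γ (γ (s x)) (Y' x) k) := by
  have hds : ∀ t ∈ I, HasDerivAt s (γ' t 0)⁻¹ (γ t 0) := fun t ht =>
    hasDerivAt_leftInverse_of_isOpen hIopen (fun t ht => hd1 t ht 0) ht
      (hd2 t ht 0).continuousAt (hpos t ht).ne' hs
  refine ⟨fun x k => γ' (s x) k / γ' (s x) 0,
    fun x k => (γ'' (s x) k * γ' (s x) 0 - γ' (s x) k * γ'' (s x) 0) / γ' (s x) 0 ^ 2 *
      (γ' (s x) 0)⁻¹, ?_, ?_, ?_⟩
  · rintro _ ⟨t, ht, rfl⟩ k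
    simp only [hs t ht, div_eq_mul_inv]
    exact HasDerivAt.comp_of_eq _ (hd1 t ht k) (hds t ht) (hs t ht).symm
  · rintro _ ⟨t, ht, rfl⟩ k
    simp only [hs t ht]
    exact HasDerivAt.comp_of_eq _ ((hd2 t ht k).fun_div (hd2 t ht 0) (hpos t ht).ne')
      (hds t ht) (hs t ht).symm
  · rintro _ ⟨t, ht, rfl⟩ k hk
    have h0 := (hpos t ht).ne'
    simp only [hs t ht]
    rw [quotRHS_eq_of_apply_zero_eq_one hΓsymm _ (div_self h0) hk]
    have rescale (l : Fin N) : ∑ i, ∑ j, Γ l i j (γ t) * (γ' t i / γ' t 0) * (γ' t j / γ' t 0) =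
        -γ'' t l / γ' t 0 ^ 2 := by
      rw [← eq_neg_of_add_eq_zero_right (hgeo t ht l)]
      simp only [Finset.sum_div]
      exact Finset.sum_congr rfl fun i _ => Finset.sum_congr rfl fun j _ => by field_simp
    rw [rescale, rescale]
    field_simp
    ring
end

section
/- Let N ≥ 2, let U ⊆ ℝ^N be open, and let Γ^k_{ij} : U → ℝ be smooth functions with Γ^k_{ij} = Γ^k_{ji}. Let F : U × ℝ^{N−1} → ℝ be a function such that for every C² geodesic γ = (γ¹,…,γ^N) : I → U (i.e., (γ^k)″ + Σ_{i,j} Γ^k_{ij}(γ)(γ^i)′(γ^j)′ = 0 on an open interval I) with (γ¹)′ > 0 on I, the function t ↦ F(γ(t), (γ²)′(t)/(γ¹)′(t), …, (γ^N)′(t)/(γ¹)′(t)) is constant on I. Then for every C² solution (Y²,…,Y^N) : J → ℝ^{N−1} of the quotient system on an open interval J, with (x, Y²(x),…,Y^N(x)) ∈ U for all x ∈ J, the function x ↦ F(x, Y²(x), …, Y^N(x), (Y²)′(x), …, (Y^N)′(x)) is constant on J. -/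
/-- The point `(x, Y²(x), …, Y^N(x))` of a solution of the quotient system. -/
def liftPt (N : ℕ) [NeZero N] (Y : ℝ → Fin N → ℝ) (x : ℝ) : Fin N → ℝ :=
  fun i => if i = 0 then x else Y x i

/-- A continuous function on an open interval has an antiderivative there. -/
theorem exists_antideriv_of_continuousOn {J : Set ℝ} (hJ : IsOpen J) (hJc : J.OrdConnected)
    {f : ℝ → ℝ} (hf : ContinuousOn f J) {a : ℝ} (ha : a ∈ J) :
    ∃ G : ℝ → ℝ, ∀ x ∈ J, HasDerivAt G (f x) x := by
  refine ⟨fun x => ∫ t in a..x, f t, fun x hx => ?_⟩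
  exact intervalIntegral.integral_hasDerivAt_right
    ((hf.mono (hJc.uIcc_subset ha hx)).intervalIntegrable)
    (hf.stronglyMeasurableAtFilter hJ x hx) (hf.continuousAt (hJ.mem_nhds hx))

/-- A function with continuous positive derivative on an open interval `J` maps it onto an open
interval, with a differentiable inverse. -/
theorem exists_inverse_of_hasDerivAt_pos {J : Set ℝ} (hJ : IsOpen J) (hJc : J.OrdConnected)
    {T f : ℝ → ℝ} (hT : ∀ x ∈ J, HasDerivAt T (f x) x) (hf : ContinuousOn f J)
    (hpos : ∀ x ∈ J, 0 < f x) :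
    IsOpen (T '' J) ∧ (T '' J).OrdConnected ∧
      ∃ g : ℝ → ℝ, ∀ x ∈ J, g (T x) = x ∧ HasDerivAt g (f x)⁻¹ (T x) := by
  have hTc : ContinuousOn T J := fun x hx => (hT x hx).continuousAt.continuousWithinAt
  have hstrict : ∀ x ∈ J, HasStrictDerivAt T (f x) x := fun x hx =>
    hasStrictDerivAt_of_hasDerivAt_of_continuousAt
      (Filter.eventually_of_mem (hJ.mem_nhds hx) hT) (hf.continuousAt (hJ.mem_nhds hx))
  have hinj : Set.InjOn T J := by
    refine (strictMonoOn_of_deriv_pos hJc.convex hTc fun x hx => ?_).injOn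
    rw [(hT x (interior_subset hx)).deriv]
    exact hpos x (interior_subset hx)
  refine ⟨?_, ?_, Function.invFunOn T J, fun x hx => ⟨hinj.leftInvOn_invFunOn hx, ?_⟩⟩
  · rw [isOpen_iff_mem_nhds]
    rintro _ ⟨x, hx, rfl⟩
    rw [← (hstrict x hx).map_nhds_eq (hpos x hx).ne']
    exact Filter.image_mem_map (hJ.mem_nhds hx)
  · exact (hJc.isPreconnected.image T hTc).ordConnected
  · exact ((hstrict x hx).to_local_left_inverse (hpos x hx).ne'
      (Filter.eventually_of_mem (hJ.mem_nhds hx) fun y hy => hinj.leftInvOn_invFunOn hy)).hasDerivAt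

/-- The slope vector `(1, v²,…, v^N)`. -/
def liftSlope (N : ℕ) [NeZero N] (v : Fin N → ℝ) : Fin N → ℝ :=
  fun i => if i = 0 then 1 else v i

/-- A symmetric quadratic form at `(1, v)`, expanded by degree in `v`. -/
theorem sum_mul_liftSlope (N : ℕ) [NeZero N] (a : Fin N → Fin N → ℝ)
    (ha : ∀ i j, a i j = a j i) (v : Fin N → ℝ) :
    ∑ i, ∑ j, a i j * liftSlope N v i * liftSlope N v j =
      a 0 0 + 2 * ∑ i ∈ Finset.univ.erase 0, a 0 i * v i +
        ∑ i ∈ Finset.univ.erase 0, ∑ j ∈ Finset.univ.erase 0, a i j * v i * v j := by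
  have split : ∀ f : Fin N → ℝ, ∑ i, f i = f 0 + ∑ i ∈ Finset.univ.erase 0, f i :=
    fun f => (Finset.add_sum_erase _ f (Finset.mem_univ 0)).symm
  have h0 : liftSlope N v 0 = 1 := if_pos rfl
  have h1 : ∀ i ∈ Finset.univ.erase (0 : Fin N), liftSlope N v i = v i :=
    fun i hi => if_neg (Finset.ne_of_mem_erase hi)
  have hrow : ∀ i, ∑ j, a i j * liftSlope N v i * liftSlope N v j =
      a 0 i * liftSlope N v i +
        ∑ j ∈ Finset.univ.erase 0, a i j * liftSlope N v i * v j := by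
    intro i
    rw [split, h0, ha i 0, mul_one]
    congr 1
    exact Finset.sum_congr rfl fun j hj => by rw [h1 j hj]
  simp_rw [hrow]
  rw [split, h0, Finset.sum_add_distrib]
  have hlin : ∑ i ∈ Finset.univ.erase 0, a 0 i * liftSlope N v i =
      ∑ i ∈ Finset.univ.erase 0, a 0 i * v i :=
    Finset.sum_congr rfl fun i hi => by rw [h1 i hi]
  have hquad : ∑ i ∈ Finset.univ.erase 0, ∑ j ∈ Finset.univ.erase 0,
      a i j * liftSlope N v i * v j =
      ∑ i ∈ Finset.univ.erase 0, ∑ j ∈ Finset.univ.erase 0, a i j * v i * v j :=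
    Finset.sum_congr rfl fun i hi => by rw [h1 i hi]
  rw [hlin, hquad]
  simp only [mul_one]
  ring

theorem quotRHS_eq (N : ℕ) [NeZero N] (Γ : Fin N → Fin N → Fin N → (Fin N → ℝ) → ℝ)
    (hΓ : ∀ k i j p, Γ k i j p = Γ k j i p) (p v : Fin N → ℝ) {k : Fin N} (hk : k ≠ 0) :
    quotRHS N Γ p v k =
      v k * ∑ i, ∑ j, Γ 0 i j p * liftSlope N v i * liftSlope N v j -
        ∑ i, ∑ j, Γ k i j p * liftSlope N v i * liftSlope N v j := by
  have hk' : k ∈ Finset.univ.erase (0 : Fin N) := Finset.mem_erase.2 ⟨hk, Finset.mem_univ k⟩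
  rw [sum_mul_liftSlope N (fun i j => Γ 0 i j p) (fun i j => hΓ 0 i j p),
    sum_mul_liftSlope N (fun i j => Γ k i j p) (fun i j => hΓ k i j p), quotRHS]
  have hlin : ∑ i ∈ Finset.univ.erase 0,
      (2 * Γ k 0 i p - (if k = i then (1 : ℝ) else 0) * Γ 0 0 0 p) * v i =
      2 * ∑ i ∈ Finset.univ.erase 0, Γ k 0 i p * v i - Γ 0 0 0 p * v k := by
    simp_rw [sub_mul, Finset.sum_sub_distrib, ite_mul, zero_mul, one_mul]
    rw [Finset.sum_ite_eq, if_pos hk', Finset.mul_sum]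
    simp only [mul_assoc]
  have hquad : ∑ i ∈ Finset.univ.erase 0, ∑ j ∈ Finset.univ.erase 0,
      (Γ k i j p - 2 * (if k = i then (1 : ℝ) else 0) * Γ 0 0 j p) * v i * v j =
      ∑ i ∈ Finset.univ.erase 0, ∑ j ∈ Finset.univ.erase 0, Γ k i j p * v i * v j -
        2 * v k * ∑ j ∈ Finset.univ.erase 0, Γ 0 0 j p * v j := by
    have hterm : ∀ i ∈ Finset.univ.erase (0 : Fin N), ∑ j ∈ Finset.univ.erase 0,
        (Γ k i j p - 2 * (if k = i then (1 : ℝ) else 0) * Γ 0 0 j p) * v i * v j =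
        ∑ j ∈ Finset.univ.erase 0, Γ k i j p * v i * v j -
          if k = i then 2 * v i * ∑ j ∈ Finset.univ.erase 0, Γ 0 0 j p * v j else 0 := by
      intro i _
      split_ifs
      · rw [Finset.mul_sum, ← Finset.sum_sub_distrib]
        exact Finset.sum_congr rfl fun j _ => by ring
      · simp
    rw [Finset.sum_congr rfl hterm, Finset.sum_sub_distrib, Finset.sum_ite_eq, if_pos hk']
  rw [hlin, hquad]
  simp_rw [← Finset.sum_mul]
  ring

/-- If `F` is a first integral of the geodesic flow (as a function of the point and the
slopes `γ^i{}' / γ^1{}'`), then `F` is a first integral of the quotient system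
(the projective connection). -/
theorem stmt_7 (N : ℕ) (hN : 2 ≤ N) [NeZero N]
    (U : Set (Fin N → ℝ)) (hU : IsOpen U)
    (Γ : Fin N → Fin N → Fin N → (Fin N → ℝ) → ℝ)
    (hΓs : ∀ k i j, ContDiffOn ℝ (⊤ : ℕ∞) (Γ k i j) U)
    (hΓsymm : ∀ k i j p, Γ k i j p = Γ k j i p)
    (F : (Fin N → ℝ) → (Fin N → ℝ) → ℝ)
    (hF : ∀ (I : Set ℝ), IsOpen I → I.OrdConnected →
      ∀ (γ γ' γ'' : ℝ → Fin N → ℝ),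
        (∀ t ∈ I, γ t ∈ U) →
        (∀ t ∈ I, ∀ k, HasDerivAt (fun τ => γ τ k) (γ' t k) t) →
        (∀ t ∈ I, ∀ k, HasDerivAt (fun τ => γ' τ k) (γ'' t k) t) →
        (∀ t ∈ I, ∀ k, γ'' t k + ∑ i, ∑ j, Γ k i j (γ t) * γ' t i * γ' t j = 0) →
        (∀ t ∈ I, 0 < γ' t 0) →
        ∀ t₁ ∈ I, ∀ t₂ ∈ I,
          F (γ t₁) (fun i => γ' t₁ i / γ' t₁ 0) = F (γ t₂) (fun i => γ' t₂ i / γ' t₂ 0)) :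
    ∀ (J : Set ℝ), IsOpen J → J.OrdConnected →
      ∀ (Y Y' Y'' : ℝ → Fin N → ℝ),
        (∀ x ∈ J, liftPt N Y x ∈ U) →
        (∀ x ∈ J, ∀ k, k ≠ 0 → HasDerivAt (fun z => Y z k) (Y' x k) x) →
        (∀ x ∈ J, ∀ k, k ≠ 0 → HasDerivAt (fun z => Y' z k) (Y'' x k) x) →
        (∀ x ∈ J, ∀ k, k ≠ 0 → Y'' x k = quotRHS N Γ (liftPt N Y x) (Y' x) k) →
        ∀ x₁ ∈ J, ∀ x₂ ∈ J,
          F (liftPt N Y x₁) (fun i => if i = 0 then 1 else Y' x₁ i) =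
          F (liftPt N Y x₂) (fun i => if i = 0 then 1 else Y' x₂ i) := by
  intro J hJ hJc Y Y' Y'' hU' hY hY' hode x₁ hx₁ x₂ hx₂
  have hpt : ∀ x ∈ J, ∀ k,
      HasDerivAt (fun z => liftPt N Y z k) (liftSlope N (Y' x) k) x := by
    intro x hx k
    by_cases hk : k = 0
    · simpa [liftPt, liftSlope, hk] using hasDerivAt_id' x
    · simpa [liftPt, liftSlope, hk] using hY x hx k hk
  have hslope : ∀ x ∈ J, ∀ k, HasDerivAt (fun z => liftSlope N (Y' z) k)
      (if k = 0 then 0 else Y'' x k) x := by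
    intro x hx k
    by_cases hk : k = 0
    · simpa [liftSlope, hk] using hasDerivAt_const x (1 : ℝ)
    · simpa [liftSlope, hk] using hY' x hx k hk
  let Q : Fin N → ℝ → ℝ := fun k x =>
    ∑ i, ∑ j, Γ k i j (liftPt N Y x) * liftSlope N (Y' x) i * liftSlope N (Y' x) j
  have hQ : ContinuousOn (Q 0) J := by
    have hptc : ContinuousOn (liftPt N Y) J := continuousOn_pi.2 fun k x hx =>
      (hpt x hx k).continuousAt.continuousWithinAt
    have hsc : ∀ k, ContinuousOn (fun x => liftSlope N (Y' x) k) J := fun k x hx =>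
      (hslope x hx k).continuousAt.continuousWithinAt
    exact continuousOn_finsetSum _ fun i _ => continuousOn_finsetSum _ fun j _ =>
      (((hΓs 0 i j).continuousOn.comp hptc hU').mul (hsc i)).mul (hsc j)
  obtain ⟨B, hB⟩ := exists_antideriv_of_continuousOn hJ hJc hQ hx₁
  have hexp : ContinuousOn (fun x => Real.exp (B x)) J := fun x hx =>
    (hB x hx).exp.continuousAt.continuousWithinAt
  obtain ⟨T, hT⟩ := exists_antideriv_of_continuousOn hJ hJc hexp hx₁
  obtain ⟨hI, hIc, g, hg⟩ :=
    exists_inverse_of_hasDerivAt_pos hJ hJc hT hexp fun x _ => Real.exp_pos _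
  have hmain := hF (T '' J) hI hIc (fun t => liftPt N Y (g t))
    (fun t k => liftSlope N (Y' (g t)) k * Real.exp (-B (g t)))
    (fun t k => ((if k = 0 then 0 else Y'' (g t) k) - liftSlope N (Y' (g t)) k * Q 0 (g t)) *
      (Real.exp (-B (g t)) * Real.exp (-B (g t)))) ?_ ?_ ?_ ?_ ?_
    (T x₁) ⟨x₁, hx₁, rfl⟩ (T x₂) ⟨x₂, hx₂, rfl⟩
  · have hs0 : ∀ x, liftSlope N (Y' x) 0 = 1 := fun x => if_pos rfl
    simp only [(hg x₁ hx₁).1, (hg x₂ hx₂).1, hs0, one_mul,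
      mul_div_cancel_right₀ _ (Real.exp_ne_zero _)] at hmain
    exact hmain
  · rintro _ ⟨x, hx, rfl⟩
    simpa only [(hg x hx).1] using hU' x hx
  · rintro _ ⟨x, hx, rfl⟩ k
    obtain ⟨hgx, hdg⟩ := hg x hx
    rw [← Real.exp_neg] at hdg
    have h := hpt x hx k
    simp only [hgx]
    exact h.comp_of_eq (T x) hdg hgx.symm
  · rintro _ ⟨x, hx, rfl⟩ k
    obtain ⟨hgx, hdg⟩ := hg x hx
    rw [← Real.exp_neg] at hdg
    have h := ((hslope x hx k).mul (hB x hx).neg.exp).comp_of_eq (T x) hdg hgx.symm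
    simp only [hgx]
    refine h.congr_deriv ?_
    simp only [Pi.neg_apply]
    ring
  · rintro _ ⟨x, hx, rfl⟩ k
    simp only [(hg x hx).1]
    have hsum : ∑ i, ∑ j, Γ k i j (liftPt N Y x) *
        (liftSlope N (Y' x) i * Real.exp (-B x)) * (liftSlope N (Y' x) j * Real.exp (-B x)) =
        Q k x * (Real.exp (-B x) * Real.exp (-B x)) := by
      simp only [Q, Finset.sum_mul]
      exact Finset.sum_congr rfl fun i _ => Finset.sum_congr rfl fun j _ => by ring
    rw [hsum, ← add_mul]
    refine mul_eq_zero_of_left ?_ _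
    by_cases hk : k = 0
    · simp [hk, liftSlope]
    · rw [if_neg hk, hode x hx k hk, quotRHS_eq N Γ hΓsymm _ _ hk]
      simp only [liftSlope, if_neg hk, Q]
      ring
  · rintro t -
    simp only [liftSlope, if_true, one_mul]
    exact Real.exp_pos _
end

section
/- Let N ≥ 2 and let g = (g_{ij}) be a smooth field of symmetric invertible N×N matrices on an open set U ⊆ ℝ^N, with Christoffel symbols Γ^k_{ij} := ½ Σ_l g^{kl}(∂_i g_{lj} + ∂_j g_{li} − ∂_l g_{ij}). Let h = (h_{ij}) be a smooth field of symmetric N×N matrices on U such that for every C² geodesic γ : I → U of Γ, the function t ↦ Σ_{i,j} h_{ij}(γ(t))·(γ^i)′(t)(γ^j)′(t) is constant on I. Then for every C² solution (Y²,…,Y^N) : J → ℝ^{N−1} of the quotient system of Γ on an open interval J, with (x, Y²(x),…,Y^N(x)) ∈ U for all x ∈ J and with the function Q(x) := g₁₁ + 2Σ_{m=2}^N g_{1m}(Y^m)′ + Σ_{m,n=2}^N g_{mn}(Y^m)′(Y^n)′ (all g's evaluated at (x,Y²(x),…,Y^N(x))) nonvanishing on J, the function x ↦ (h₁₁ + 2Σ_{m=2}^N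 h_{1m}(Y^m)′ + Σ_{m,n=2}^N h_{mn}(Y^m)′(Y^n)′)/Q(x) is constant on J. -/
/-- Partial derivative `∂_i f` of a function on `ℝ^N`. -/
noncomputable def pderiv' (N : ℕ) (f : (Fin N → ℝ) → ℝ) (i : Fin N) (p : Fin N → ℝ) : ℝ :=
  fderiv ℝ f p (Pi.single i 1)

/-- The Christoffel symbols `Γ^k_{ij} = ½ Σ_l g^{kl}(∂_i g_{lj} + ∂_j g_{li} − ∂_l g_{ij})`
of a field `g` of invertible symmetric matrices. -/
noncomputable def christoffel (N : ℕ) (g : (Fin N → ℝ) → Fin N → Fin N → ℝ)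
    (k i j : Fin N) (p : Fin N → ℝ) : ℝ :=
  (1 / 2) * ∑ l, (Matrix.of (g p))⁻¹ k l *
    (pderiv' N (fun q => g q l j) i p + pderiv' N (fun q => g q l i) j p
      - pderiv' N (fun q => g q i j) l p)

open Finset in
/-- Splitting off the index `0` in a symmetric quadratic form evaluated at `(1, v)`. -/
theorem sum_quadratic_slope {N : ℕ} [NeZero N] (B : Fin N → Fin N → ℝ)
    (hB : ∀ i j, B i j = B j i) (v w : Fin N → ℝ) (hw0 : w 0 = 1) (hw : ∀ i, i ≠ 0 → w i = v i) :
    ∑ i, ∑ j, B i j * w i * w j =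
      B 0 0 + 2 * ∑ m ∈ univ.erase 0, B 0 m * v m
        + ∑ m ∈ univ.erase 0, ∑ n ∈ univ.erase 0, B m n * v m * v n := by
  have split : ∀ f : Fin N → ℝ, ∑ i, f i = f 0 + ∑ i ∈ univ.erase 0, f i :=
    fun f => (add_sum_erase univ f (mem_univ 0)).symm
  have hwv : ∀ m ∈ univ.erase (0 : Fin N), w m = v m := fun m hm => hw m (ne_of_mem_erase hm)
  have row : ∀ i, ∑ j, B i j * w i * w j
      = B 0 i * w i + ∑ n ∈ univ.erase 0, B i n * w i * v n := fun i => by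
    rw [split, hw0, mul_one, hB i 0]
    exact congrArg _ (sum_congr rfl fun n hn => by rw [hwv n hn])
  simp only [row]
  have e1 : ∑ m ∈ univ.erase 0, B 0 m * w m = ∑ m ∈ univ.erase 0, B 0 m * v m :=
    sum_congr rfl fun m hm => by rw [hwv m hm]
  have e2 : ∑ m ∈ univ.erase 0, ∑ n ∈ univ.erase 0, B m n * w m * v n
      = ∑ m ∈ univ.erase 0, ∑ n ∈ univ.erase 0, B m n * v m * v n :=
    sum_congr rfl fun m hm => by rw [hwv m hm]
  rw [sum_add_distrib, split (fun i => B 0 i * w i), split (fun i => ∑ n ∈ _, _), hw0, e1, e2]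
  simp only [mul_one]
  ring

/-- The partial derivative of a function that agrees with another one on an open set. -/
theorem pderiv'_congr {N : ℕ} {U : Set (Fin N → ℝ)} (hU : IsOpen U) {f f' : (Fin N → ℝ) → ℝ}
    (hf : ∀ p ∈ U, f p = f' p) (i : Fin N) {p : Fin N → ℝ} (hp : p ∈ U) :
    pderiv' N f i p = pderiv' N f' i p := by
  unfold pderiv'
  rw [Filter.EventuallyEq.fderiv_eq]
  filter_upwards [hU.mem_nhds hp] with q hq using hf q hq

theorem christoffel_symm {N : ℕ} {U : Set (Fin N → ℝ)} (hU : IsOpen U)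
    {g : (Fin N → ℝ) → Fin N → Fin N → ℝ} (hg : ∀ p ∈ U, ∀ i j, g p i j = g p j i)
    (k i j : Fin N) {p : Fin N → ℝ} (hp : p ∈ U) :
    christoffel N g k i j p = christoffel N g k j i p := by
  unfold christoffel
  congr 1
  refine Finset.sum_congr rfl fun l _ => ?_
  rw [pderiv'_congr hU (fun q hq => hg q hq i j) l hp]
  ring

/-- Lowering the upper index of the Christoffel symbols. -/
theorem sum_mul_christoffel {N : ℕ} {g : (Fin N → ℝ) → Fin N → Fin N → ℝ} {p : Fin N → ℝ}
    (hg : IsUnit (Matrix.of (g p)).det) (m i j : Fin N) :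
    ∑ k, g p m k * christoffel N g k i j p =
      (1 / 2) * (pderiv' N (fun q => g q m j) i p + pderiv' N (fun q => g q m i) j p
        - pderiv' N (fun q => g q i j) m p) := by
  set F : Fin N → ℝ := fun l => pderiv' N (fun q => g q l j) i p
    + pderiv' N (fun q => g q l i) j p - pderiv' N (fun q => g q i j) l p with hF
  have h1 : (Matrix.of (g p)).mulVec ((Matrix.of (g p))⁻¹.mulVec F) = F := by
    rw [Matrix.mulVec_mulVec, Matrix.mul_nonsing_inv _ hg, Matrix.one_mulVec]
  have h2 := congrFun h1 m
  simp only [Matrix.mulVec, dotProduct, Matrix.of_apply] at h2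
  change _ = (1 / 2) * F m
  rw [← h2, Finset.mul_sum]
  refine Finset.sum_congr rfl fun k _ => ?_
  simp only [christoffel, hF]
  ring

/-- The quadratic form `Σ Γ^k_{ij} w^i w^j` of the Christoffel symbols. -/
noncomputable def christoffelForm (N : ℕ) (g : (Fin N → ℝ) → Fin N → Fin N → ℝ)
    (p w : Fin N → ℝ) (k : Fin N) : ℝ :=
  ∑ i, ∑ j, christoffel N g k i j p * w i * w j

theorem christoffelForm_div (N : ℕ) (g : (Fin N → ℝ) → Fin N → Fin N → ℝ)
    (p w : Fin N → ℝ) (c : ℝ) (k : Fin N) :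
    christoffelForm N g p (fun i => w i / c) k = christoffelForm N g p w k / c ^ 2 := by
  simp only [christoffelForm, Finset.sum_div]
  refine Finset.sum_congr rfl fun i _ => Finset.sum_congr rfl fun j _ => ?_
  ring

open Finset in
theorem sum_mul_christoffelForm {N : ℕ} {g : (Fin N → ℝ) → Fin N → Fin N → ℝ} {p : Fin N → ℝ}
    (hg : IsUnit (Matrix.of (g p)).det) (w : Fin N → ℝ) :
    ∑ m, ∑ k, g p m k * w m * christoffelForm N g p w k =
      (1 / 2) * ∑ i, ∑ j, (∑ l, pderiv' N (fun q => g q i j) l p * w l) * w i * w j := by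
  have h1 : ∀ m, ∑ k, g p m k * w m * christoffelForm N g p w k
      = ∑ i, ∑ j, (∑ k, g p m k * christoffel N g k i j p) * (w m * w i * w j) := fun m => by
    simp only [christoffelForm, mul_sum, sum_mul]
    rw [sum_comm]
    refine sum_congr rfl fun i _ => ?_
    rw [sum_comm]
    exact sum_congr rfl fun j _ => sum_congr rfl fun k _ => by ring
  simp only [h1, sum_mul_christoffel hg]
  set D : Fin N → Fin N → Fin N → ℝ := fun a b c => pderiv' N (fun q => g q a b) c p
  have e1 : ∑ m, ∑ i, ∑ j, D m j i * (w m * w i * w j)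
      = ∑ i, ∑ j, (∑ l, D i j l * w l) * w i * w j := by
    simp only [sum_mul]
    refine sum_congr rfl fun m _ => ?_
    rw [sum_comm]
    exact sum_congr rfl fun i _ => sum_congr rfl fun j _ => by ring
  have e2 : ∑ m, ∑ i, ∑ j, D m i j * (w m * w i * w j)
      = ∑ i, ∑ j, (∑ l, D i j l * w l) * w i * w j := by
    simp only [sum_mul]
    exact sum_congr rfl fun m _ => sum_congr rfl fun i _ => sum_congr rfl fun j _ => by ring
  have e3 : ∑ m, ∑ i, ∑ j, D i j m * (w m * w i * w j)
      = ∑ i, ∑ j, (∑ l, D i j l * w l) * w i * w j := by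
    simp only [sum_mul]
    rw [sum_comm]
    refine sum_congr rfl fun m _ => ?_
    rw [sum_comm]
    exact sum_congr rfl fun i _ => sum_congr rfl fun j _ => by ring
  calc ∑ m, ∑ i, ∑ j, 1 / 2 * (D m j i + D m i j - D i j m) * (w m * w i * w j)
      = (1 / 2) * (∑ m, ∑ i, ∑ j, D m j i * (w m * w i * w j)
          + ∑ m, ∑ i, ∑ j, D m i j * (w m * w i * w j)
          - ∑ m, ∑ i, ∑ j, D i j m * (w m * w i * w j)) := by
        simp only [← sum_add_distrib, ← sum_sub_distrib, mul_sum]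
        exact sum_congr rfl fun m _ => sum_congr rfl fun i _ => sum_congr rfl fun j _ => by ring
    _ = _ := by rw [e1, e2, e3]; ring

open Finset in
/-- In terms of the full velocity `w = (1, v)`, the quotient system says that the covariant
acceleration is proportional to `w`. -/
theorem quotRHS_eq_s8 {N : ℕ} [NeZero N] {U : Set (Fin N → ℝ)} (hU : IsOpen U)
    {g : (Fin N → ℝ) → Fin N → Fin N → ℝ} (hg : ∀ p ∈ U, ∀ i j, g p i j = g p j i)
    {p : Fin N → ℝ} (hp : p ∈ U) (v w : Fin N → ℝ) (hw0 : w 0 = 1)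
    (hw : ∀ i, i ≠ 0 → w i = v i) {k : Fin N} (hk : k ≠ 0) :
    quotRHS N (christoffel N g) p v k =
      christoffelForm N g p w 0 * w k - christoffelForm N g p w k := by
  have form : ∀ k, christoffelForm N g p w k = _ := fun k =>
    sum_quadratic_slope (fun i j => christoffel N g k i j p)
      (fun i j => christoffel_symm hU hg k i j hp) v w hw0 hw
  have hmem : k ∈ univ.erase (0 : Fin N) := by simp [hk]
  rw [form, form, hw k hk]
  unfold quotRHS
  have e1 : ∑ i ∈ univ.erase 0, (2 * christoffel N g k 0 i p
        - (if k = i then (1 : ℝ) else 0) * christoffel N g 0 0 0 p) * v i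
      = 2 * ∑ i ∈ univ.erase 0, christoffel N g k 0 i p * v i
        - christoffel N g 0 0 0 p * v k := by
    simp only [sub_mul, sum_sub_distrib, ite_mul, one_mul, zero_mul, sum_ite_eq, hmem, if_true,
      mul_sum, mul_assoc]
  have e2 : ∑ i ∈ univ.erase 0, ∑ j ∈ univ.erase 0, (christoffel N g k i j p
        - 2 * (if k = i then (1 : ℝ) else 0) * christoffel N g 0 0 j p) * v i * v j
      = ∑ i ∈ univ.erase 0, ∑ j ∈ univ.erase 0, christoffel N g k i j p * v i * v j
        - 2 * (∑ j ∈ univ.erase 0, christoffel N g 0 0 j p * v j) * v k := by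
    have : ∀ i, ∑ j ∈ univ.erase 0, (christoffel N g k i j p
        - 2 * (if k = i then (1 : ℝ) else 0) * christoffel N g 0 0 j p) * v i * v j
      = ∑ j ∈ univ.erase 0, christoffel N g k i j p * v i * v j
        - if k = i then 2 * (∑ j ∈ univ.erase 0, christoffel N g 0 0 j p * v j) * v i else 0 := by
      intro i
      split_ifs
      · rw [mul_sum, sum_mul, ← sum_sub_distrib]
        exact sum_congr rfl fun j _ => by ring
      · simp
    simp only [this, sum_sub_distrib, sum_ite_eq, hmem, if_true]
  rw [e1, e2, ← sum_congr rfl fun i _ => sum_mul .., ← sum_mul]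
  ring

open Finset in
/-- If the covariant acceleration of a curve is `A` times its velocity, then the square length of
the velocity has logarithmic derivative `2A`. -/
theorem hasDerivAt_metric_velocity {N : ℕ} {g : (Fin N → ℝ) → Fin N → Fin N → ℝ}
    {γ w : ℝ → Fin N → ℝ} {w' : Fin N → ℝ} {x A : ℝ}
    (hdiff : ∀ i j, DifferentiableAt ℝ (fun p => g p i j) (γ x))
    (hsymm : ∀ i j, g (γ x) i j = g (γ x) j i)
    (hinv : IsUnit (Matrix.of (g (γ x))).det)
    (hγ : ∀ k, HasDerivAt (fun z => γ z k) (w x k) x)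
    (hw : ∀ k, HasDerivAt (fun z => w z k) (w' k) x)
    (hw' : ∀ k, w' k = A * w x k - christoffelForm N g (γ x) (w x) k) :
    HasDerivAt (fun z => ∑ i, ∑ j, g (γ z) i j * w z i * w z j)
      (2 * A * ∑ i, ∑ j, g (γ x) i j * w x i * w x j) x := by
  have hcomp : ∀ i j, HasDerivAt (fun z => g (γ z) i j)
      (∑ l, pderiv' N (fun q => g q i j) l (γ x) * w x l) x := fun i j => by
    have h1 := (hdiff i j).hasFDerivAt.comp_hasDerivAt x (hasDerivAt_pi.2 hγ)
    refine h1.congr_deriv ?_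
    conv_lhs => rw [pi_eq_sum_univ' (w x), map_sum]
    refine sum_congr rfl fun l _ => ?_
    rw [map_smul, smul_eq_mul, mul_comm]
    rfl
  have h2 : HasDerivAt (fun z => ∑ i, ∑ j, g (γ z) i j * w z i * w z j) _ x :=
    HasDerivAt.fun_sum fun i _ => HasDerivAt.fun_sum fun j _ =>
      ((hcomp i j).fun_mul (hw i)).fun_mul (hw j)
  refine h2.congr_deriv ?_
  have key := sum_mul_christoffelForm hinv (w x)
  have swap : ∑ i, ∑ j, g (γ x) i j * christoffelForm N g (γ x) (w x) i * w x j
      = ∑ m, ∑ k, g (γ x) m k * w x m * christoffelForm N g (γ x) (w x) k := by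
    rw [sum_comm]
    exact sum_congr rfl fun i _ => sum_congr rfl fun j _ => by rw [hsymm]; ring
  calc _ = ∑ i, ∑ j, (∑ l, pderiv' N (fun q => g q i j) l (γ x) * w x l) * w x i * w x j
        + 2 * A * ∑ i, ∑ j, g (γ x) i j * w x i * w x j
        - ∑ i, ∑ j, g (γ x) i j * christoffelForm N g (γ x) (w x) i * w x j
        - ∑ m, ∑ k, g (γ x) m k * w x m * christoffelForm N g (γ x) (w x) k := by
        simp only [mul_sum (s := univ) (a := 2 * A), ← sum_add_distrib, ← sum_sub_distrib, hw']
        exact sum_congr rfl fun i _ => sum_congr rfl fun j _ => by ring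
    _ = _ := by rw [swap, key]; ring

/-- A positive continuous function on an open interval is the speed of a reparametrization. -/
theorem exists_reparametrization {J : Set ℝ} (hJ : IsOpen J) (hJc : J.OrdConnected) {s : ℝ → ℝ}
    (hs : ContinuousOn s J) (hpos : ∀ x ∈ J, 0 < s x) :
    ∃ (I : Set ℝ) (S : ℝ → ℝ), IsOpen I ∧ I.OrdConnected ∧ (∀ t ∈ I, S t ∈ J) ∧
      (∀ t ∈ I, HasDerivAt S (s (S t))⁻¹ t) ∧ ∀ x ∈ J, ∃ t ∈ I, S t = x := by
  rcases J.eq_empty_or_nonempty with rfl | ⟨x₀, hx₀⟩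
  · exact ⟨∅, id, isOpen_empty, Set.ordConnected_empty, by simp, by simp, by simp⟩
  set T : ℝ → ℝ := fun x => ∫ z in x₀..x, s z with hT
  have hderiv : ∀ x ∈ J, HasDerivAt T (s x) x := fun x hx =>
    intervalIntegral.integral_hasDerivAt_right
      ((hs.mono (hJc.uIcc_subset hx₀ hx)).intervalIntegrable)
      (hs.stronglyMeasurableAtFilter hJ x hx) (hs.continuousAt (hJ.mem_nhds hx))
  have hcont : ContinuousOn T J := fun x hx => (hderiv x hx).continuousAt.continuousWithinAt
  have hmono : StrictMonoOn T J := by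
    refine strictMonoOn_of_deriv_pos hJc.convex hcont fun x hx => ?_
    rw [hJ.interior_eq] at hx
    rw [(hderiv x hx).deriv]
    exact hpos x hx
  have hIc : (T '' J).OrdConnected := (hJc.isPreconnected.image T hcont).ordConnected
  have hI : IsOpen (T '' J) := by
    rw [isOpen_iff_mem_nhds]
    rintro _ ⟨x, hx, rfl⟩
    obtain ⟨a, b, hxab, hab⟩ := mem_nhds_iff_exists_Ioo_subset.1 (hJ.mem_nhds hx)
    obtain ⟨c, hac, hcx⟩ := exists_between hxab.1
    obtain ⟨d, hxd, hdb⟩ := exists_between hxab.2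
    have hc : c ∈ J := hab ⟨hac, hcx.trans hxab.2⟩
    have hd : d ∈ J := hab ⟨hxab.1.trans hxd, hdb⟩
    exact Filter.mem_of_superset (Ioo_mem_nhds (hmono hc hx hcx) (hmono hx hd hxd))
      (Set.Ioo_subset_Icc_self.trans (hIc.out ⟨c, hc, rfl⟩ ⟨d, hd, rfl⟩))
  set S := Function.invFunOn T J
  have hSJ : ∀ t ∈ T '' J, S t ∈ J := fun t ht => Function.invFunOn_mem ht
  have hTS : ∀ t ∈ T '' J, T (S t) = t := fun t ht => Function.invFunOn_eq ht
  have hST : ∀ x ∈ J, S (T x) = x := fun x hx =>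
    hmono.injOn (hSJ _ ⟨x, hx, rfl⟩) hx (hTS _ ⟨x, hx, rfl⟩)
  have hSmono : StrictMonoOn S (T '' J) := fun t ht u hu htu => by
    rwa [← hmono.lt_iff_lt (hSJ t ht) (hSJ u hu), hTS t ht, hTS u hu]
  have himage : S '' (T '' J) = J := by
    ext x
    constructor
    · rintro ⟨t, ht, rfl⟩
      exact hSJ t ht
    · exact fun hx => ⟨T x, ⟨x, hx, rfl⟩, hST x hx⟩
  refine ⟨T '' J, S, hI, hIc, hSJ, fun t ht => ?_, fun x hx => ⟨T x, ⟨x, hx, rfl⟩, hST x hx⟩⟩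
  have hSc : ContinuousAt S t := hSmono.continuousAt_of_image_mem_nhds (hI.mem_nhds ht)
    (by rw [himage]; exact hJ.mem_nhds (hSJ t ht))
  refine (hderiv _ (hSJ t ht)).of_local_left_inverse hSc (hpos _ (hSJ t ht)).ne' ?_
  filter_upwards [hI.mem_nhds ht] with u hu using hTS u hu

/-- A nonvanishing continuous function on an interval becomes positive after multiplication by a
constant nonzero factor. -/
theorem exists_const_mul_pos {J : Set ℝ} (hJc : J.OrdConnected) {Q : ℝ → ℝ}
    (hQ : ContinuousOn Q J) (hne : ∀ x ∈ J, Q x ≠ 0) : ∃ ε : ℝ, ε ≠ 0 ∧ ∀ x ∈ J, 0 < ε * Q x := by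
  rcases J.eq_empty_or_nonempty with rfl | ⟨x₀, hx₀⟩
  · exact ⟨1, one_ne_zero, by simp⟩
  refine ⟨Q x₀, hne x₀ hx₀, fun x hx => ?_⟩
  by_contra! hle
  have hc : (Q '' J).OrdConnected := (hJc.isPreconnected.image Q hQ).ordConnected
  have h0 : (0 : ℝ) ∈ Set.uIcc (Q x₀) (Q x) := by
    rw [Set.mem_uIcc]
    rcases lt_or_gt_of_ne (hne x₀ hx₀) with h | h
    · exact Or.inl ⟨h.le, by nlinarith⟩
    · exact Or.inr ⟨by nlinarith, h.le⟩
  obtain ⟨z, hz, hz0⟩ := hc.uIcc_subset ⟨x₀, hx₀, rfl⟩ ⟨x, hx, rfl⟩ h0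
  exact hne z hz hz0

/-- If `h_{ij} ẏ^i ẏ^j` is a quadratic first integral of the geodesic flow of the metric
`g`, then the rational function `(h₁₁ + 2h_{1m}y^m_x + h_{mn}y^m_x y^n_x) /
(g₁₁ + 2g_{1m}y^m_x + g_{mn}y^m_x y^n_x)` is a first integral of the quotient system
(projective connection) of `g`. -/
theorem stmt_8 (N : ℕ) (hN : 2 ≤ N) [NeZero N]
    (U : Set (Fin N → ℝ)) (hU : IsOpen U)
    (g h : (Fin N → ℝ) → Fin N → Fin N → ℝ)
    (hg_smooth : ∀ i j, ContDiffOn ℝ (⊤ : ℕ∞) (fun p => g p i j) U)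
    (hg_symm : ∀ p ∈ U, ∀ i j, g p i j = g p j i)
    (hg_inv : ∀ p ∈ U, IsUnit (Matrix.of (g p)).det)
    (hh_smooth : ∀ i j, ContDiffOn ℝ (⊤ : ℕ∞) (fun p => h p i j) U)
    (hh_symm : ∀ p ∈ U, ∀ i j, h p i j = h p j i)
    (hint : ∀ (I : Set ℝ), IsOpen I → I.OrdConnected →
      ∀ (γ γ' γ'' : ℝ → Fin N → ℝ),
        (∀ t ∈ I, γ t ∈ U) →
        (∀ t ∈ I, ∀ k, HasDerivAt (fun τ => γ τ k) (γ' t k) t) →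
        (∀ t ∈ I, ∀ k, HasDerivAt (fun τ => γ' τ k) (γ'' t k) t) →
        (∀ t ∈ I, ∀ k,
          γ'' t k + ∑ i, ∑ j, christoffel N g k i j (γ t) * γ' t i * γ' t j = 0) →
        ∀ t₁ ∈ I, ∀ t₂ ∈ I,
          (∑ i, ∑ j, h (γ t₁) i j * γ' t₁ i * γ' t₁ j) =
          (∑ i, ∑ j, h (γ t₂) i j * γ' t₂ i * γ' t₂ j)) :
    ∀ (J : Set ℝ), IsOpen J → J.OrdConnected →
      ∀ (Y Y' Y'' : ℝ → Fin N → ℝ),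
        (∀ x ∈ J, liftPt N Y x ∈ U) →
        (∀ x ∈ J, ∀ k, k ≠ 0 → HasDerivAt (fun z => Y z k) (Y' x k) x) →
        (∀ x ∈ J, ∀ k, k ≠ 0 → HasDerivAt (fun z => Y' z k) (Y'' x k) x) →
        (∀ x ∈ J, ∀ k, k ≠ 0 →
          Y'' x k = quotRHS N (christoffel N g) (liftPt N Y x) (Y' x) k) →
        (∀ x ∈ J,
          g (liftPt N Y x) 0 0
            + 2 * ∑ m ∈ Finset.univ.erase 0, g (liftPt N Y x) 0 m * Y' x m
            + ∑ m ∈ Finset.univ.erase 0, ∑ n ∈ Finset.univ.erase 0,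
                g (liftPt N Y x) m n * Y' x m * Y' x n ≠ 0) →
        ∀ x₁ ∈ J, ∀ x₂ ∈ J,
          (h (liftPt N Y x₁) 0 0
              + 2 * ∑ m ∈ Finset.univ.erase 0, h (liftPt N Y x₁) 0 m * Y' x₁ m
              + ∑ m ∈ Finset.univ.erase 0, ∑ n ∈ Finset.univ.erase 0,
                  h (liftPt N Y x₁) m n * Y' x₁ m * Y' x₁ n) /
            (g (liftPt N Y x₁) 0 0
              + 2 * ∑ m ∈ Finset.univ.erase 0, g (liftPt N Y x₁) 0 m * Y' x₁ m
              + ∑ m ∈ Finset.univ.erase 0, ∑ n ∈ Finset.univ.erase 0,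
                  g (liftPt N Y x₁) m n * Y' x₁ m * Y' x₁ n) =
          (h (liftPt N Y x₂) 0 0
              + 2 * ∑ m ∈ Finset.univ.erase 0, h (liftPt N Y x₂) 0 m * Y' x₂ m
              + ∑ m ∈ Finset.univ.erase 0, ∑ n ∈ Finset.univ.erase 0,
                  h (liftPt N Y x₂) m n * Y' x₂ m * Y' x₂ n) /
            (g (liftPt N Y x₂) 0 0
              + 2 * ∑ m ∈ Finset.univ.erase 0, g (liftPt N Y x₂) 0 m * Y' x₂ m
              + ∑ m ∈ Finset.univ.erase 0, ∑ n ∈ Finset.univ.erase 0,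
                  g (liftPt N Y x₂) m n * Y' x₂ m * Y' x₂ n) := by
  intro J hJ hJc Y Y' Y'' hYU hY hY' hquot hQne
  set γ := liftPt N Y with hγdef
  set w : ℝ → Fin N → ℝ := fun x k => if k = 0 then 1 else Y' x k with hwdef
  set A : ℝ → ℝ := fun x => christoffelForm N g (γ x) (w x) 0 with hAdef
  set w' : ℝ → Fin N → ℝ := fun x k =>
    A x * w x k - christoffelForm N g (γ x) (w x) k with hw'def
  have hw0 : ∀ x, w x 0 = 1 := fun x => if_pos rfl
  have hwv : ∀ x i, i ≠ 0 → w x i = Y' x i := fun x i hi => if_neg hi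
  have hγ : ∀ x ∈ J, ∀ k, HasDerivAt (fun z => γ z k) (w x k) x := by
    intro x hx k
    by_cases hk : k = 0
    · simpa [hγdef, liftPt, hwdef, hk] using hasDerivAt_id' x
    · simpa [hγdef, liftPt, hwdef, hk] using hY x hx k hk
  have hw : ∀ x ∈ J, ∀ k, HasDerivAt (fun z => w z k) (w' x k) x := by
    intro x hx k
    by_cases hk : k = 0
    · subst hk
      have : w' x 0 = 0 := by simp [hw'def, hw0, hAdef]
      simpa only [hw0, this] using hasDerivAt_const x (1 : ℝ)
    · have : w' x k = Y'' x k := by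
        rw [hquot x hx k hk, quotRHS_eq_s8 hU hg_symm (hYU x hx) _ _ (hw0 x) (hwv x) hk]
      simpa only [hwv _ k hk, this] using hY' x hx k hk
  set G : ℝ → ℝ := fun x => ∑ i, ∑ j, g (γ x) i j * w x i * w x j with hGdef
  set H : ℝ → ℝ := fun x => ∑ i, ∑ j, h (γ x) i j * w x i * w x j with hHdef
  have hGeq : ∀ x ∈ J, G x = _ := fun x hx =>
    sum_quadratic_slope (g (γ x)) (hg_symm _ (hYU x hx)) (Y' x) (w x) (hw0 x) (hwv x)
  have hHeq : ∀ x ∈ J, H x = _ := fun x hx =>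
    sum_quadratic_slope (h (γ x)) (hh_symm _ (hYU x hx)) (Y' x) (w x) (hw0 x) (hwv x)
  have hGderiv : ∀ x ∈ J, HasDerivAt G (2 * A x * G x) x := fun x hx =>
    hasDerivAt_metric_velocity
      (fun i j => ((hg_smooth i j).contDiffAt (hU.mem_nhds (hYU x hx))).differentiableAt (by simp))
      (hg_symm _ (hYU x hx)) (hg_inv _ (hYU x hx)) (hγ x hx) (hw x hx) (fun k => rfl)
  have hGne : ∀ x ∈ J, G x ≠ 0 := fun x hx => by
    rw [hGeq x hx]
    exact hQne x hx
  obtain ⟨ε, hε, hεG⟩ := exists_const_mul_pos hJc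
    (fun x hx => (hGderiv x hx).continuousAt.continuousWithinAt) hGne
  set s : ℝ → ℝ := fun x => √(ε * G x) with hsdef
  have hspos : ∀ x ∈ J, 0 < s x := fun x hx => Real.sqrt_pos.2 (hεG x hx)
  have hssq : ∀ x ∈ J, s x ^ 2 = ε * G x := fun x hx => Real.sq_sqrt (hεG x hx).le
  have hsderiv : ∀ x ∈ J, HasDerivAt s (A x * s x) x := fun x hx => by
    refine (((hGderiv x hx).const_mul ε).sqrt (hεG x hx).ne').congr_deriv ?_
    change _ / (2 * s x) = _
    have := (hspos x hx).ne'
    field_simp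
    linear_combination (-(A x)) * hssq x hx
  obtain ⟨I, S, hI, hIc, hSJ, hS, hsurj⟩ := exists_reparametrization hJ hJc
    (fun x hx => (hsderiv x hx).continuousAt.continuousWithinAt) hspos
  have hconst := hint I hI hIc (fun t => γ (S t)) (fun t k => w (S t) k / s (S t))
    (fun t k => -christoffelForm N g (γ (S t)) (fun i => w (S t) i / s (S t)) k)
    (fun t ht => hYU _ (hSJ t ht))
    (fun t ht k => by
      rw [div_eq_mul_inv]
      exact (hγ _ (hSJ t ht) k).comp t (hS t ht))
    (fun t ht k => by
      have hx := hSJ t ht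
      have hne := (hspos _ hx).ne'
      refine ((((hw _ hx k).div (hsderiv _ hx) hne).comp t (hS t ht))).congr_deriv ?_
      rw [christoffelForm_div]
      simp only [hw'def]
      field_simp
      ring)
    (fun t ht k => neg_add_cancel (christoffelForm N g _ _ k))
  have hHG : ∀ x ∈ J, ∀ t, S t = x →
      ∑ i, ∑ j, h (γ (S t)) i j * (w (S t) i / s (S t)) * (w (S t) j / s (S t))
        = ε⁻¹ * (H x / G x) := by
    rintro x hx t rfl
    rw [← div_eq_inv_mul, div_div, mul_comm (G _), ← hssq _ hx, hHdef]
    simp only [Finset.sum_div]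
    exact Finset.sum_congr rfl fun i _ => Finset.sum_congr rfl fun j _ => by ring
  intro x₁ hx₁ x₂ hx₂
  obtain ⟨t₁, ht₁, hSt₁⟩ := hsurj x₁ hx₁
  obtain ⟨t₂, ht₂, hSt₂⟩ := hsurj x₂ hx₂
  have heq := hconst t₁ ht₁ t₂ ht₂
  rw [hHG x₁ hx₁ t₁ hSt₁, hHG x₂ hx₂ t₂ hSt₂] at heq
  have := mul_left_cancel₀ (inv_ne_zero hε) heq
  rwa [hGeq x₁ hx₁, hGeq x₂ hx₂, hHeq x₁ hx₁, hHeq x₂ hx₂] at this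
end

section
/- Let (x, y) : I → ℝ² be a C² curve on an open interval I with sin(y(t)) ≠ 0 for all t ∈ I, satisfying the geodesic equations of the round sphere metric sin²(y)dx² + dy²: x″(t) = −2·cot(y(t))·x′(t)·y′(t) and y″(t) = sin(y(t))·cos(y(t))·x′(t)². Then the function t ↦ sin(y(t))³·cos(x(t))·cos(y(t))·x′(t)² + sin(y(t))²·sin(x(t))·x′(t)·y′(t) is constant on I. -/
open Real in
/-- Along every geodesic of the round sphere metric `sin²(y)dx² + dy²` (with `sin y ≠ 0`),
the function `sin³(y)cos(x)cos(y)ẋ² + sin²(y)sin(x)ẋẏ` is constant: it is the quadratic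
first integral associated with the projective vector field `X = sin²(y)cos(x)∂_y`. -/
theorem stmt_12 (I : Set ℝ) (hIopen : IsOpen I) (hIconn : I.OrdConnected)
    (x y x' y' x'' y'' : ℝ → ℝ)
    (hsin : ∀ t ∈ I, sin (y t) ≠ 0)
    (hdx : ∀ t ∈ I, HasDerivAt x (x' t) t)
    (hdx' : ∀ t ∈ I, HasDerivAt x' (x'' t) t)
    (hdy : ∀ t ∈ I, HasDerivAt y (y' t) t)
    (hdy' : ∀ t ∈ I, HasDerivAt y' (y'' t) t)
    (hgeo1 : ∀ t ∈ I, x'' t = -2 * (cos (y t) / sin (y t)) * x' t * y' t)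
    (hgeo2 : ∀ t ∈ I, y'' t = sin (y t) * cos (y t) * (x' t) ^ 2) :
    ∀ t₁ ∈ I, ∀ t₂ ∈ I,
      sin (y t₁) ^ 3 * cos (x t₁) * cos (y t₁) * (x' t₁) ^ 2
          + sin (y t₁) ^ 2 * sin (x t₁) * x' t₁ * y' t₁ =
        sin (y t₂) ^ 3 * cos (x t₂) * cos (y t₂) * (x' t₂) ^ 2
          + sin (y t₂) ^ 2 * sin (x t₂) * x' t₂ * y' t₂ := by
  have hderiv : ∀ t ∈ I, HasDerivAt (fun t => sin (y t) ^ 3 * cos (x t) * cos (y t) * (x' t) ^ 2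
      + sin (y t) ^ 2 * sin (x t) * x' t * y' t) 0 t := by
    intro t ht
    have hs := hsin t ht
    have hsy := (hdy t ht).sin
    have hcy := (hdy t ht).cos
    have hsx := (hdx t ht).sin
    have hcx := (hdx t ht).cos
    have h := ((((hsy.fun_pow 3).fun_mul hcx).fun_mul hcy).fun_mul ((hdx' t ht).fun_pow 2)).fun_add
      ((((hsy.fun_pow 2).fun_mul hsx).fun_mul (hdx' t ht)).fun_mul (hdy' t ht))
    refine h.congr_deriv ?_
    have hx'' : sin (y t) * x'' t = -2 * cos (y t) * x' t * y' t := by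
      rw [hgeo1 t ht]
      field_simp
    rw [hgeo2 t ht]
    push_cast
    linear_combination
      (2 * sin (y t) ^ 2 * cos (x t) * cos (y t) * x' t + sin (y t) * sin (x t) * y' t) * hx''
        + sin (y t) ^ 2 * cos (x t) * x' t ^ 2 * y' t * (sin_sq_add_cos_sq (y t)) * (-1)
  intro t₁ h₁ t₂ h₂
  exact hIopen.is_const_of_deriv_eq_zero hIconn.isPreconnected
    (fun t ht => (hderiv t ht).differentiableAt.differentiableWithinAt)
    (fun t ht => (hderiv t ht).deriv) h₁ h₂
end

section
/- Let y : J → ℝ be a C² function on an open interval J with sin(y(x)) ≠ 0 for all x ∈ J, satisfying the projective connection ODE of the round sphere: y″(x) = sin(y(x))·cos(y(x)) + 2·cot(y(x))·y′(x)². Then the function x ↦ (sin(y(x))³·cos(x)·cos(y(x)) + sin(y(x))²·sin(x)·y′(x)) / (sin(y(x))² + y′(x)²) is constant on J. -/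
open Real in
/-- Along every solution of the projective connection `y″ = sin(y)cos(y) + 2cot(y)(y′)²`
of the round sphere (with `sin y ≠ 0`), the rational function
`(sin³(y)cos(x)cos(y) + sin²(y)sin(x)y′) / (sin²(y) + y′²)` is constant. -/
theorem stmt_13 (J : Set ℝ) (hJopen : IsOpen J) (hJconn : J.OrdConnected)
    (y y' y'' : ℝ → ℝ)
    (hsin : ∀ x ∈ J, sin (y x) ≠ 0)
    (hd1 : ∀ x ∈ J, HasDerivAt y (y' x) x)
    (hd2 : ∀ x ∈ J, HasDerivAt y' (y'' x) x)
    (hode : ∀ x ∈ J,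
      y'' x = sin (y x) * cos (y x) + 2 * (cos (y x) / sin (y x)) * (y' x) ^ 2) :
    ∀ x₁ ∈ J, ∀ x₂ ∈ J,
      (sin (y x₁) ^ 3 * cos x₁ * cos (y x₁) + sin (y x₁) ^ 2 * sin x₁ * y' x₁)
          / (sin (y x₁) ^ 2 + (y' x₁) ^ 2) =
        (sin (y x₂) ^ 3 * cos x₂ * cos (y x₂) + sin (y x₂) ^ 2 * sin x₂ * y' x₂)
          / (sin (y x₂) ^ 2 + (y' x₂) ^ 2) := by
  have hderiv : ∀ x ∈ J, HasDerivAt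
      (fun t => (sin (y t) ^ 3 * cos t * cos (y t) + sin (y t) ^ 2 * sin t * y' t)
        / (sin (y t) ^ 2 + (y' t) ^ 2)) 0 x := by
    intro x hx
    have hs := hsin x hx
    have hD : sin (y x) ^ 2 + y' x ^ 2 ≠ 0 := by positivity
    have hS := (hd1 x hx).sin
    have hC := (hd1 x hx).cos
    have hN := (((hS.fun_pow 3).fun_mul (hasDerivAt_cos x)).fun_mul hC).fun_add
      (((hS.fun_pow 2).fun_mul (hasDerivAt_sin x)).fun_mul (hd2 x hx))
    refine (hN.fun_div ((hS.fun_pow 2).fun_add ((hd2 x hx).fun_pow 2)) hD).congr_deriv ?_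
    rw [hode x hx, div_eq_zero_iff]
    left
    push_cast
    field_simp
    linear_combination (-(sin (y x) ^ 2 * y' x * cos x * (sin (y x) ^ 2 + y' x ^ 2))) *
      sin_sq_add_cos_sq (y x)
  intro x₁ h₁ x₂ h₂
  exact hJopen.is_const_of_deriv_eq_zero hJconn.isPreconnected
    (fun x hx => (hderiv x hx).differentiableAt.differentiableWithinAt)
    (fun x hx => (hderiv x hx).deriv) h₁ h₂
end

section
/- Let y : J → ℝ be a C² function on an open interval J with x² + y(x) ≠ 0 and y′(x) ≠ 0 for all x ∈ J, satisfying the ODE y″(x) = (2x·y′(x) − y′(x)²)/(x² + y(x)). Then the function x ↦ (2x·y′(x) − (y(x) + x²))/y′(x) is constant on J. -/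
/-- Along every solution of the projective connection
`y″ = (2x·y′ − y′²)/(x² + y)` of the superintegrable metric `(y + x²)dxdy`,
the rational function `Ĩ₁ = (2x·y′ − (y + x²))/y′` is constant. -/
theorem stmt_14 (J : Set ℝ) (hJopen : IsOpen J) (hJconn : J.OrdConnected)
    (y y' y'' : ℝ → ℝ)
    (hne : ∀ x ∈ J, x ^ 2 + y x ≠ 0)
    (hy'ne : ∀ x ∈ J, y' x ≠ 0)
    (hd1 : ∀ x ∈ J, HasDerivAt y (y' x) x)
    (hd2 : ∀ x ∈ J, HasDerivAt y' (y'' x) x)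
    (hode : ∀ x ∈ J, y'' x = (2 * x * y' x - (y' x) ^ 2) / (x ^ 2 + y x)) :
    ∀ x₁ ∈ J, ∀ x₂ ∈ J,
      (2 * x₁ * y' x₁ - (y x₁ + x₁ ^ 2)) / y' x₁ =
        (2 * x₂ * y' x₂ - (y x₂ + x₂ ^ 2)) / y' x₂ := by
  have hderiv : ∀ x ∈ J, HasDerivAt
      (fun x => (2 * x * y' x - (y x + x ^ 2)) / y' x) 0 x := by
    intro x hx
    have hp := hy'ne x hx
    have hode' : y'' x * (x ^ 2 + y x) = 2 * x * y' x - y' x ^ 2 :=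
      (eq_div_iff (hne x hx)).mp (hode x hx)
    have hnum : HasDerivAt (fun x => 2 * x * y' x - (y x + x ^ 2))
        (2 * y' x + 2 * x * y'' x - (y' x + 2 * x)) x := by
      refine ((((hasDerivAt_id x).const_mul 2).mul (hd2 x hx)).sub
        ((hd1 x hx).add (hasDerivAt_pow 2 x))).congr_deriv ?_
      simp
    refine (hnum.div (hd2 x hx) hp).congr_deriv ?_
    rw [div_eq_zero_iff]
    left
    linear_combination hode'
  intro x₁ hx₁ x₂ hx₂
  exact hJopen.is_const_of_deriv_eq_zero hJconn.isPreconnected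
    (fun x hx => (hderiv x hx).differentiableAt.differentiableWithinAt)
    (fun x hx => (hderiv x hx).deriv) hx₁ hx₂
end

section
/- Let y : J → ℝ be a C² function on an open interval J with x² + y(x) ≠ 0 and y′(x) ≠ 0 for all x ∈ J, satisfying the ODE y″(x) = (2x·y′(x) − y′(x)²)/(x² + y(x)). Then the function x ↦ (9(y(x) + x²)·y′(x)² − 4x·(x² + 9y(x))·y′(x) + 12y(x)·(x² + y(x)))/y′(x) is constant on J. -/
/-- Along every solution of the projective connection
`y″ = (2x·y′ − y′²)/(x² + y)` of the superintegrable metric `(y + x²)dxdy`,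
the rational function `Ĩ₂ = (9(y+x²)y′² − 4x(x²+9y)y′ + 12y(x²+y))/y′` is constant. -/
theorem stmt_15 (J : Set ℝ) (hJopen : IsOpen J) (hJconn : J.OrdConnected)
    (y y' y'' : ℝ → ℝ)
    (hne : ∀ x ∈ J, x ^ 2 + y x ≠ 0)
    (hy'ne : ∀ x ∈ J, y' x ≠ 0)
    (hd1 : ∀ x ∈ J, HasDerivAt y (y' x) x)
    (hd2 : ∀ x ∈ J, HasDerivAt y' (y'' x) x)
    (hode : ∀ x ∈ J, y'' x = (2 * x * y' x - (y' x) ^ 2) / (x ^ 2 + y x)) :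
    ∀ x₁ ∈ J, ∀ x₂ ∈ J,
      (9 * (y x₁ + x₁ ^ 2) * (y' x₁) ^ 2 - 4 * x₁ * (x₁ ^ 2 + 9 * y x₁) * y' x₁
          + 12 * y x₁ * (x₁ ^ 2 + y x₁)) / y' x₁ =
        (9 * (y x₂ + x₂ ^ 2) * (y' x₂) ^ 2 - 4 * x₂ * (x₂ ^ 2 + 9 * y x₂) * y' x₂
          + 12 * y x₂ * (x₂ ^ 2 + y x₂)) / y' x₂ := by
  intro x₁ hx₁ x₂ hx₂
  have hderiv : ∀ x ∈ J, HasDerivAt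
      (fun t => (9 * (y t + t ^ 2) * (y' t) ^ 2 - 4 * t * (t ^ 2 + 9 * y t) * y' t
          + 12 * y t * (t ^ 2 + y t)) / y' t) 0 x := by
    intro x hx
    have hD := hne x hx
    have hp := hy'ne x hx
    have h1 := hd1 x hx
    have h2 := hd2 x hx
    rw [hode x hx] at h2
    have hid := hasDerivAt_id' x
    have hsq := hid.fun_pow 2
    have hnum := (((((h1.fun_add hsq).const_mul 9).fun_mul (h2.fun_pow 2)).fun_sub
      (((hid.const_mul 4).fun_mul (hsq.fun_add (h1.const_mul 9))).fun_mul h2)).fun_add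
      ((h1.const_mul 12).fun_mul (hsq.fun_add h1)))
    refine (hnum.fun_div h2 hp).congr_deriv ?_
    push_cast
    field_simp
    ring
  exact hJopen.is_const_of_deriv_eq_zero hJconn.isPreconnected
    (fun x hx => (hderiv x hx).differentiableAt.differentiableWithinAt)
    (fun x hx => (hderiv x hx).deriv) hx₁ hx₂
end

section
/- Let x, y, p, c₁, c₂ be real numbers with p ≠ 0. If (2x·p − (y + x²))/p = c₁ and (9(y + x²)·p² − 4x·(x² + 9y)·p + 12y·(x² + y))/p = c₂, then x⁴ + 4c₁x³ − 6x²y − 12c₁xy + 9y² − 2c₂x + 12c₁²y + c₁c₂ = 0. -/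
/-- Eliminating the slope `p = y_x` from the two first integrals
`Ĩ₁ = (2xp − (y+x²))/p = c₁` and `Ĩ₂ = (9(y+x²)p² − 4x(x²+9y)p + 12y(x²+y))/p = c₂`
yields the quartic equation of the unparametrized geodesics. -/
theorem stmt_16 (x y p c₁ c₂ : ℝ) (hp : p ≠ 0)
    (h1 : (2 * x * p - (y + x ^ 2)) / p = c₁)
    (h2 : (9 * (y + x ^ 2) * p ^ 2 - 4 * x * (x ^ 2 + 9 * y) * p + 12 * y * (x ^ 2 + y)) / p = c₂) :
    x ^ 4 + 4 * c₁ * x ^ 3 - 6 * x ^ 2 * y - 12 * c₁ * x * y + 9 * y ^ 2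
      - 2 * c₂ * x + 12 * c₁ ^ 2 * y + c₁ * c₂ = 0 := by
  subst h1 h2
  field_simp
  ring
end

section
/- Consider the linear second-order ODE y²·Y″(y) − ½(y − 3)·Y′(y) + ½·Y(y) = 0. (i) The function Y : (0,∞) → ℝ defined by Y(y) = 2√6·(y − 3)·∫₀^{√(3/(2y))} e^{t²} dt + 6·√y·e^{3/(2y)} is twice differentiable and satisfies the ODE at every y > 0. (ii) The function Z : (−∞,0) → ℝ defined by Z(y) = 2√6·(y − 3)·∫₀^{√(−3/(2y))} e^{−t²} dt − 6·√(−y)·e^{3/(2y)} is twice differentiable and satisfies the ODE at every y < 0. -/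
/-- The solution `Y(y) = 2√6·(y−3)·∫₀^{√(3/(2y))} e^{t²} dt + 6√y·e^{3/(2y)}` for `y > 0`. -/
noncomputable def Yfun (y : ℝ) : ℝ :=
  2 * Real.sqrt 6 * (y - 3) * (∫ t in (0 : ℝ)..Real.sqrt (3 / (2 * y)), Real.exp (t ^ 2))
    + 6 * Real.sqrt y * Real.exp (3 / (2 * y))

/-- The solution `Z(y) = 2√6·(y−3)·∫₀^{√(−3/(2y))} e^{−t²} dt − 6√(−y)·e^{3/(2y)}` for `y < 0`. -/
noncomputable def Zfun (y : ℝ) : ℝ :=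
  2 * Real.sqrt 6 * (y - 3) * (∫ t in (0 : ℝ)..Real.sqrt (-3 / (2 * y)), Real.exp (-t ^ 2))
    - 6 * Real.sqrt (-y) * Real.exp (3 / (2 * y))

theorem hasDerivAt_const_div_two_mul (c : ℝ) {y : ℝ} (hy : y ≠ 0) :
    HasDerivAt (fun x : ℝ => c / (2 * x)) (-c / (2 * y ^ 2)) y := by
  refine ((hasDerivAt_const y c).div ((hasDerivAt_id y).const_mul 2)
    (mul_ne_zero two_ne_zero hy)).congr_deriv ?_
  simp only [id]
  field_simp
  ring

theorem sqrt_three_div_two_mul {w : ℝ} (hw : 0 < w) :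
    Real.sqrt (3 / (2 * w)) = Real.sqrt 6 / (2 * Real.sqrt w) := by
  rw [Real.sqrt_eq_iff_mul_self_eq (by positivity) (by positivity)]
  field_simp
  rw [Real.sq_sqrt hw.le, Real.sq_sqrt (by norm_num : (0 : ℝ) ≤ 6)]
  ring

theorem hasDerivAt_integral_comp {h u : ℝ → ℝ} {u' y : ℝ} (hh : Continuous h)
    (hu : HasDerivAt u u' y) :
    HasDerivAt (fun x => ∫ t in (0 : ℝ)..u x, h t) (h (u y) * u') y :=
  (hh.integral_hasStrictDerivAt 0 (u y)).hasDerivAt.comp y hu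

theorem hasDerivAt_integral_exp_sq {y : ℝ} (hy : 0 < y) :
    HasDerivAt
      (fun x : ℝ => 2 * Real.sqrt 6 *
        ∫ t in (0 : ℝ)..Real.sqrt (3 / (2 * x)), Real.exp (t ^ 2))
      (-3 * Real.exp (3 / (2 * y)) / (y * Real.sqrt y)) y := by
  have hu := (hasDerivAt_const_div_two_mul 3 hy.ne').sqrt (by positivity)
  have hh : Continuous fun t : ℝ => Real.exp (t ^ 2) := by fun_prop
  refine ((hasDerivAt_integral_comp hh hu).const_mul (2 * Real.sqrt 6)).congr_deriv ?_
  have hs := Real.sqrt_pos.2 hy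
  have hsq := Real.sq_sqrt hy.le
  rw [Real.sq_sqrt (by positivity), sqrt_three_div_two_mul hy]
  generalize Real.exp (3 / (2 * y)) = E
  field_simp
  linear_combination -E * hsq

theorem hasDerivAt_integral_exp_neg_sq {y : ℝ} (hy : y < 0) :
    HasDerivAt
      (fun x : ℝ => 2 * Real.sqrt 6 *
        ∫ t in (0 : ℝ)..Real.sqrt (-3 / (2 * x)), Real.exp (-t ^ 2))
      (-3 * Real.exp (3 / (2 * y)) / (y * Real.sqrt (-y))) y := by
  have hw : 0 < -y := neg_pos.2 hy
  have heq : -3 / (2 * y) = 3 / (2 * -y) := by rw [mul_neg, div_neg, neg_div]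
  have hpos : 0 < -3 / (2 * y) := by rw [heq]; positivity
  have hu := (hasDerivAt_const_div_two_mul (-3) hy.ne).sqrt hpos.ne'
  have hh : Continuous fun t : ℝ => Real.exp (-t ^ 2) := by fun_prop
  refine ((hasDerivAt_integral_comp hh hu).const_mul (2 * Real.sqrt 6)).congr_deriv ?_
  have hs := Real.sqrt_pos.2 hw
  have hsq := Real.sq_sqrt hw.le
  have hy0 := hy.ne
  rw [Real.sq_sqrt hpos.le, heq, sqrt_three_div_two_mul hw, ← heq, ← neg_div, neg_neg]
  generalize Real.exp (3 / (2 * y)) = E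
  field_simp
  linear_combination E * hsq

theorem hasDerivAt_Yfun {y : ℝ} (hy : 0 < y) :
    HasDerivAt Yfun
      (2 * Real.sqrt 6 * ∫ t in (0 : ℝ)..Real.sqrt (3 / (2 * y)), Real.exp (t ^ 2)) y := by
  have h := (((hasDerivAt_id y).sub_const 3).mul (hasDerivAt_integral_exp_sq hy)).add
    (((hasDerivAt_id y).sqrt hy.ne').const_mul 6 |>.mul
      (hasDerivAt_const_div_two_mul 3 hy.ne').exp)
  refine (h.congr_deriv ?_).congr_of_eventuallyEq (.of_forall fun x => ?_)
  · have hs := Real.sqrt_pos.2 hy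
    have hsq := Real.sq_sqrt hy.le
    simp only [id]
    generalize Real.exp (3 / (2 * y)) = E
    field_simp
    rw [hsq]
    ring
  · simp only [Yfun, Pi.add_apply, Pi.mul_apply, id]
    ring

theorem hasDerivAt_Zfun {y : ℝ} (hy : y < 0) :
    HasDerivAt Zfun
      (2 * Real.sqrt 6 * ∫ t in (0 : ℝ)..Real.sqrt (-3 / (2 * y)), Real.exp (-t ^ 2)) y := by
  have hw : 0 < -y := neg_pos.2 hy
  have h := (((hasDerivAt_id y).sub_const 3).mul (hasDerivAt_integral_exp_neg_sq hy)).sub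
    (((hasDerivAt_id y).neg.sqrt hw.ne').const_mul 6 |>.mul
      (hasDerivAt_const_div_two_mul 3 hy.ne).exp)
  refine (h.congr_deriv ?_).congr_of_eventuallyEq (.of_forall fun x => ?_)
  · have hs := Real.sqrt_pos.2 hw
    have hsq := Real.sq_sqrt hw.le
    have hy0 := hy.ne
    simp only [id, Pi.neg_apply]
    generalize Real.exp (3 / (2 * y)) = E
    field_simp
    rw [hsq]
    ring
  · simp only [Zfun, Pi.sub_apply, Pi.mul_apply, Pi.neg_apply, id]
    ring

/-- The functions `Yfun` (on `(0,∞)`) and `Zfun` (on `(−∞,0)`) are twice differentiable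
and satisfy the ODE `y²·Y″ − ½(y − 3)·Y′ + ½·Y = 0` coming from the normal form (C.8). -/
theorem stmt_17 :
    (∃ Y' Y'' : ℝ → ℝ, ∀ y : ℝ, 0 < y →
      HasDerivAt Yfun (Y' y) y ∧ HasDerivAt Y' (Y'' y) y ∧
        y ^ 2 * Y'' y - (1 / 2) * (y - 3) * Y' y + (1 / 2) * Yfun y = 0) ∧
    (∃ Z' Z'' : ℝ → ℝ, ∀ y : ℝ, y < 0 →
      HasDerivAt Zfun (Z' y) y ∧ HasDerivAt Z' (Z'' y) y ∧
        y ^ 2 * Z'' y - (1 / 2) * (y - 3) * Z' y + (1 / 2) * Zfun y = 0) := by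
  refine ⟨⟨_, fun y => -3 * Real.exp (3 / (2 * y)) / (y * Real.sqrt y), fun y hy =>
      ⟨hasDerivAt_Yfun hy, hasDerivAt_integral_exp_sq hy, ?_⟩⟩,
    ⟨_, fun y => -3 * Real.exp (3 / (2 * y)) / (y * Real.sqrt (-y)), fun y hy =>
      ⟨hasDerivAt_Zfun hy, hasDerivAt_integral_exp_neg_sq hy, ?_⟩⟩⟩
  · have hs := Real.sqrt_pos.2 hy
    have hsq := Real.sq_sqrt hy.le
    simp only [Yfun]
    generalize Real.exp (3 / (2 * y)) = E
    field_simp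
    linear_combination 6 * E * hsq
  · have hs := Real.sqrt_pos.2 (neg_pos.2 hy)
    have hsq := Real.sq_sqrt (neg_pos.2 hy).le
    have hy0 := hy.ne
    simp only [Zfun]
    generalize Real.exp (3 / (2 * y)) = E
    field_simp
    linear_combination -6 * E * hsq
end

section
/- Let Ω := {(x, y, p₁, p₂) ∈ ℝ⁴ : y² + x ≠ 0} and define on Ω the smooth functions H := 2p₁p₂/(y² + x), I := p₁² − 2y·p₁p₂/(y² + x), and J := 12x·p₁² − 4y(9x + y²)·p₁p₂/(y² + x) + 9p₂². Then: (i) {H, I} = 0 and {H, J} = 0 at every point of Ω, where {F, G} := ∂F/∂p₁·∂G/∂x − ∂F/∂x·∂G/∂p₁ + ∂F/∂p₂·∂G/∂y − ∂F/∂y·∂G/∂p₂ is the canonical Poisson bracket; and (ii) the set of points of Ω at which the 4×3 Jacobian matrix of (H, I, J) with respect to (x, y, p₁, p₂) has rank 3 is open and dense in Ω. -/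
/-- Coordinates on phase space: `v 0 = x`, `v 1 = y`, `v 2 = p₁`, `v 3 = p₂`.
Partial derivative of `F` with respect to the `i`-th coordinate. -/
noncomputable def pd4 (F : (Fin 4 → ℝ) → ℝ) (i : Fin 4) (v : Fin 4 → ℝ) : ℝ :=
  deriv (fun s => F (Function.update v i s)) (v i)

/-- The free Hamiltonian `H = 2p₁p₂/(y² + x)` of the metric `(y² + x)dxdy`. -/
noncomputable def Hfun (v : Fin 4 → ℝ) : ℝ := 2 * v 2 * v 3 / ((v 1) ^ 2 + v 0)

/-- The quadratic integral `I = p₁² − 2y·p₁p₂/(y² + x)`. -/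
noncomputable def Ifun (v : Fin 4 → ℝ) : ℝ :=
  (v 2) ^ 2 - 2 * v 1 * v 2 * v 3 / ((v 1) ^ 2 + v 0)

/-- The quadratic integral `J = 12x·p₁² − 4y(9x + y²)·p₁p₂/(y² + x) + 9p₂²`. -/
noncomputable def Jfun (v : Fin 4 → ℝ) : ℝ :=
  12 * v 0 * (v 2) ^ 2 - 4 * v 1 * (9 * v 0 + (v 1) ^ 2) * v 2 * v 3 / ((v 1) ^ 2 + v 0)
    + 9 * (v 3) ^ 2

/-- The canonical Poisson bracket
`{F,G} = F_{p₁}G_x − F_xG_{p₁} + F_{p₂}G_y − F_yG_{p₂}`. -/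
noncomputable def poisson (F G : (Fin 4 → ℝ) → ℝ) (v : Fin 4 → ℝ) : ℝ :=
  pd4 F 2 v * pd4 G 0 v - pd4 F 0 v * pd4 G 2 v
    + pd4 F 3 v * pd4 G 1 v - pd4 F 1 v * pd4 G 3 v

/-- The 4×3 Jacobian matrix of `(H, I, J)` with respect to `(x, y, p₁, p₂)`. -/
noncomputable def jacHIJ (v : Fin 4 → ℝ) : Matrix (Fin 4) (Fin 3) ℝ :=
  Matrix.of fun b a => pd4 (if a = 0 then Hfun else if a = 1 then Ifun else Jfun) b v

/-- The directional derivative of `Hfun` at `v` along `e`. -/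
noncomputable def dirDerivHfun (v e : Fin 4 → ℝ) : ℝ :=
  2 * (e 2 * v 3 + v 2 * e 3) / ((v 1) ^ 2 + v 0)
    - 2 * v 2 * v 3 * (2 * v 1 * e 1 + e 0) / ((v 1) ^ 2 + v 0) ^ 2

theorem hasDerivAt_update_coord (v : Fin 4 → ℝ) (i j : Fin 4) :
    HasDerivAt (fun s => Function.update v i s j) ((Pi.single i 1 : Fin 4 → ℝ) j) (v i) :=
  hasDerivAt_pi.1 (hasDerivAt_update v i (v i)) j

theorem hasDerivAt_Hfun_update {v : Fin 4 → ℝ} (hv : (v 1) ^ 2 + v 0 ≠ 0) (i : Fin 4) :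
    HasDerivAt (fun s => Hfun (Function.update v i s)) (dirDerivHfun v (Pi.single i 1)) (v i) := by
  have h := hasDerivAt_update_coord v i
  have hne : (Function.update v i (v i) 1) ^ 2 + Function.update v i (v i) 0 ≠ 0 := by simpa
  refine ((((h 2).const_mul 2).mul (h 3)).div (((h 1).pow 2).add (h 0)) hne).congr_deriv ?_
  simp only [Function.update_eq_self, dirDerivHfun, Pi.add_apply, Pi.mul_apply, Pi.pow_apply]
  field_simp
  ring

theorem pd4_Hfun {v : Fin 4 → ℝ} (hv : (v 1) ^ 2 + v 0 ≠ 0) (i : Fin 4) :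
    pd4 Hfun i v = dirDerivHfun v (Pi.single i 1) :=
  (hasDerivAt_Hfun_update hv i).deriv

theorem Ifun_eq (v : Fin 4 → ℝ) : Ifun v = (v 2) ^ 2 - v 1 * Hfun v := by
  unfold Ifun Hfun
  ring

theorem Jfun_eq (v : Fin 4 → ℝ) :
    Jfun v = 12 * v 0 * (v 2) ^ 2 - 2 * v 1 * (9 * v 0 + (v 1) ^ 2) * Hfun v
      + 9 * (v 3) ^ 2 := by
  unfold Jfun Hfun
  ring

theorem pd4_Ifun {v : Fin 4 → ℝ} (hv : (v 1) ^ 2 + v 0 ≠ 0) (i : Fin 4) :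
    pd4 Ifun i v = 2 * v 2 * (Pi.single i 1 : Fin 4 → ℝ) 2
      - (Pi.single i 1 : Fin 4 → ℝ) 1 * Hfun v - v 1 * dirDerivHfun v (Pi.single i 1) := by
  have h := hasDerivAt_update_coord v i
  unfold pd4
  simp only [Ifun_eq]
  refine (((h 2).pow 2).sub ((h 1).mul (hasDerivAt_Hfun_update hv i))).deriv.trans ?_
  simp only [Function.update_eq_self]
  ring

theorem pd4_Jfun {v : Fin 4 → ℝ} (hv : (v 1) ^ 2 + v 0 ≠ 0) (i : Fin 4) :
    pd4 Jfun i v = 12 * (v 2) ^ 2 * (Pi.single i 1 : Fin 4 → ℝ) 0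
      + 24 * v 0 * v 2 * (Pi.single i 1 : Fin 4 → ℝ) 2
      - (18 * v 1 * (Pi.single i 1 : Fin 4 → ℝ) 0
        + (18 * v 0 + 6 * (v 1) ^ 2) * (Pi.single i 1 : Fin 4 → ℝ) 1) * Hfun v
      - 2 * v 1 * (9 * v 0 + (v 1) ^ 2) * dirDerivHfun v (Pi.single i 1)
      + 18 * v 3 * (Pi.single i 1 : Fin 4 → ℝ) 3 := by
  have h := hasDerivAt_update_coord v i
  unfold pd4
  simp only [Jfun_eq]
  refine ((((((h 0).const_mul 12).mul ((h 2).pow 2)).sub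
    ((((h 1).const_mul 2).mul (((h 0).const_mul 9).add ((h 1).pow 2))).mul
      (hasDerivAt_Hfun_update hv i))).add (((h 3).pow 2).const_mul 9))).deriv.trans ?_
  simp only [Function.update_eq_self, Pi.add_apply, Pi.mul_apply, Pi.pow_apply]
  ring

theorem poisson_Hfun_Ifun {v : Fin 4 → ℝ} (hv : (v 1) ^ 2 + v 0 ≠ 0) :
    poisson Hfun Ifun v = 0 := by
  simp only [poisson, pd4_Hfun hv, pd4_Ifun hv, dirDerivHfun, Hfun, Pi.single_apply, Fin.reduceEq,
    if_true, if_false]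
  field_simp
  ring

theorem poisson_Hfun_Jfun {v : Fin 4 → ℝ} (hv : (v 1) ^ 2 + v 0 ≠ 0) :
    poisson Hfun Jfun v = 0 := by
  simp only [poisson, pd4_Hfun hv, pd4_Jfun hv, dirDerivHfun, Hfun, Pi.single_apply, Fin.reduceEq,
    if_true, if_false]
  field_simp
  ring

theorem isOpen_domain : IsOpen {v : Fin 4 → ℝ | (v 1) ^ 2 + v 0 ≠ 0} :=
  isOpen_ne_fun (by fun_prop) (by fun_prop)

theorem continuousOn_jacHIJ : ContinuousOn jacHIJ {v : Fin 4 → ℝ | (v 1) ^ 2 + v 0 ≠ 0} := by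
  refine continuousOn_pi.2 fun b => continuousOn_pi.2 fun a => ?_
  have hH : ContinuousOn Hfun {v : Fin 4 → ℝ | (v 1) ^ 2 + v 0 ≠ 0} := by
    unfold Hfun
    exact ContinuousOn.div (by fun_prop) (by fun_prop) fun _ h => h
  have hD : ContinuousOn (fun v => dirDerivHfun v (Pi.single b 1))
      {v : Fin 4 → ℝ | (v 1) ^ 2 + v 0 ≠ 0} := by
    unfold dirDerivHfun
    exact (ContinuousOn.div (by fun_prop) (by fun_prop) fun _ h => h).sub
      (ContinuousOn.div (by fun_prop) (by fun_prop) fun _ h => pow_ne_zero 2 h)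
  fin_cases a
  · exact hD.congr fun v hv => pd4_Hfun hv b
  · refine ContinuousOn.congr ?_ fun v hv => pd4_Ifun hv b
    fun_prop
  · refine ContinuousOn.congr ?_ fun v hv => pd4_Jfun hv b
    fun_prop

theorem Matrix.rank_eq_card_iff_det_transpose_mul_self_ne_zero {m n : Type*} [Fintype m]
    [Fintype n] [DecidableEq n] (A : Matrix m n ℝ) :
    A.rank = Fintype.card n ↔ (A.transpose * A).det ≠ 0 := by
  rw [← Matrix.rank_transpose_mul_self A, ← isUnit_iff_ne_zero, ← Matrix.isUnit_iff_isUnit_det]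
  refine ⟨fun h => ?_, Matrix.rank_of_isUnit _⟩
  rw [← Matrix.linearIndependent_cols_iff_isUnit, linearIndependent_iff_card_eq_finrank_span,
    ← h, Matrix.rank_eq_finrank_span_cols]
  rfl

theorem rank_jacHIJ_eq_three {v : Fin 4 → ℝ} (hv : (v 1) ^ 2 + v 0 ≠ 0)
    (h : (v 2) ^ 2 * (3 * (v 3) ^ 2 - 6 * v 1 * v 2 * v 3
      + 2 * ((v 1) ^ 2 + v 0) * (v 2) ^ 2) ≠ 0) :
    (jacHIJ v).rank = 3 := by
  have hdet : ((jacHIJ v).submatrix ![0, 2, 3] id).det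
      = -24 / ((v 1) ^ 2 + v 0) ^ 2 * ((v 2) ^ 2 * (3 * (v 3) ^ 2 - 6 * v 1 * v 2 * v 3
      + 2 * ((v 1) ^ 2 + v 0) * (v 2) ^ 2)) := by
    rw [Matrix.det_fin_three]
    simp only [Matrix.submatrix_apply]
    simp [jacHIJ, pd4_Hfun hv, pd4_Ifun hv, pd4_Jfun hv, dirDerivHfun, Hfun]
    field_simp
    ring
  refine le_antisymm (Matrix.rank_le_width _) ?_
  have hunit : IsUnit ((jacHIJ v).submatrix ![0, 2, 3] id) := by
    rw [Matrix.isUnit_iff_isUnit_det, hdet, isUnit_iff_ne_zero]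
    exact mul_ne_zero (div_ne_zero (by norm_num) (pow_ne_zero 2 hv)) h
  calc 3 = ((jacHIJ v).submatrix ![0, 2, 3] id).rank := by
        rw [Matrix.rank_of_isUnit _ hunit, Fintype.card_fin]
    _ ≤ (jacHIJ v).rank := Matrix.rank_submatrix_le _ _ _

open Polynomial in
theorem finite_zeros_quartic {a : ℝ} (ha : a ≠ 0) (b c : ℝ) :
    {s : ℝ | s ^ 2 * (c + b * s + a * s ^ 2) = 0}.Finite := by
  have hp : (X ^ 2 * (C c + C b * X + C a * X ^ 2) : ℝ[X]) ≠ 0 := by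
    intro h
    have := congrArg (fun p => p.coeff 4) h
    simp [mul_add, coeff_X_pow, coeff_X_pow_mul'] at this
    exact ha this
  refine (Polynomial.finite_setOfPred_isRoot hp).subset fun s hs => ?_
  simpa [IsRoot] using hs

/-- On `Ω = {y² + x ≠ 0}`: the integrals `I`, `J` Poisson-commute with `H`, and the set
where the Jacobian of `(H,I,J)` has rank 3 (functional independence) is open and dense
in `Ω`; so the metric `(y² + x)dxdy` gives rise to a free second-order maximally
superintegrable system. -/
theorem stmt_19 :
    (∀ v : Fin 4 → ℝ, (v 1) ^ 2 + v 0 ≠ 0 →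
      poisson Hfun Ifun v = 0 ∧ poisson Hfun Jfun v = 0) ∧
    (IsOpen {v : Fin 4 → ℝ | ((v 1) ^ 2 + v 0 ≠ 0) ∧ (jacHIJ v).rank = 3} ∧
      ∀ v : Fin 4 → ℝ, (v 1) ^ 2 + v 0 ≠ 0 →
        v ∈ closure {w : Fin 4 → ℝ | ((w 1) ^ 2 + w 0 ≠ 0) ∧ (jacHIJ w).rank = 3}) := by
  refine ⟨fun v hv => ⟨poisson_Hfun_Ifun hv, poisson_Hfun_Jfun hv⟩, ?_, fun v hv => ?_⟩
  · have hdet : ContinuousOn (fun v => ((jacHIJ v).transpose * jacHIJ v).det)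
        {v : Fin 4 → ℝ | (v 1) ^ 2 + v 0 ≠ 0} :=
      (Continuous.matrix_det (by fun_prop : Continuous fun A : Matrix (Fin 4) (Fin 3) ℝ =>
        A.transpose * A)).comp_continuousOn continuousOn_jacHIJ
    convert hdet.isOpen_inter_preimage isOpen_domain isOpen_ne using 1
    ext v
    exact and_congr_right fun _ =>
      Matrix.rank_eq_card_iff_det_transpose_mul_self_ne_zero (jacHIJ v)
  · have hfin := finite_zeros_quartic (mul_ne_zero two_ne_zero hv) (-6 * v 1 * v 3) (3 * (v 3) ^ 2)
    have hmaps : Set.MapsTo (fun s => Function.update v 2 s)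
        {s : ℝ | s ^ 2 * (3 * (v 3) ^ 2 + -6 * v 1 * v 3 * s
          + 2 * ((v 1) ^ 2 + v 0) * s ^ 2) = 0}ᶜ
        {w : Fin 4 → ℝ | ((w 1) ^ 2 + w 0 ≠ 0) ∧ (jacHIJ w).rank = 3} := by
      intro s hs
      have hdom : (Function.update v 2 s 1) ^ 2 + Function.update v 2 s 0 ≠ 0 := by simpa
      refine ⟨hdom, rank_jacHIJ_eq_three hdom ?_⟩
      convert hs using 1
      simp
      ring_nf
    have hcont : Continuous fun s : ℝ => Function.update v 2 s :=
      continuous_const.update 2 continuous_id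
    have := map_mem_closure hcont
      (hfin.countable.dense_compl ℝ (v 2)) hmaps
    simpa using this
end
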